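/- There exists a constant β₀ ≥ 0 such that for every β ≥ β₀ and every y > 0, ∫₀^∞ e^{−2βt}·|R_{Π_n}(nt) − W′(t)|² dt + ∫₀^∞ e^{−2βt}·|R_n(nt, y) − y·W′(t)|² dt → 0 as n → ∞. -/

import Mathlib

open MeasureTheory Real Set Filter Topology

noncomputable def tailNu (ν : Measure ℝ) (y : ℝ) : ℝ := (ν (Set.Ici y)).toReal

noncomputable def itailNu (ν : Measure ℝ) (x : ℝ) : ℝ := ∫ y in Set.Ioi x, tailNu ν y

noncomputable def phi (b c : ℝ) (ν : Measure ℝ) (l : ℝ) : ℝ :=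
  b * l + c * l ^ 2 + ∫ y in Set.Ioi (0 : ℝ), (Real.exp (-l * y) - 1 + l * y) ∂ν

noncomputable def expDens (c y : ℝ) : ℝ := (1 / c) * Real.exp (-y / c)

noncomputable def gam (b c : ℝ) (ν : Measure ℝ) (η : ℕ → ℝ) (n : ℕ) : ℝ :=
  (1 / c) * max 0 (1 - b / (n : ℝ) - (1 / (n : ℝ)) * ∫ y in Set.Ioi (0 : ℝ), tailNu ν (η n + y))

noncomputable def piDens (c θn : ℝ) (Λn : Measure ℝ) (y : ℝ) : ℝ :=
  (1 - θn) * expDens c y + θn * ∫ u in Set.Icc (0 : ℝ) y, expDens c (y - u) ∂Λn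

noncomputable def piTail (c θn : ℝ) (Λn : Measure ℝ) (x : ℝ) : ℝ :=
  ∫ y in Set.Ioi x, piDens c θn Λn y

noncomputable def piTailL1 (c θn : ℝ) (Λn : Measure ℝ) : ℝ :=
  ∫ y in Set.Ioi (0 : ℝ), piTail c θn Λn y

noncomputable def convPos (f g : ℝ → ℝ) (x : ℝ) : ℝ := ∫ y in (0 : ℝ)..x, f (x - y) * g y

noncomputable def convIter (f : ℝ → ℝ) : ℕ → ℝ → ℝ
  | 0 => f
  | k + 1 => convPos f (convIter f k)

/-- Resolvent of the second kind of `f`: the sum `Σ_{k≥1} f^{*k}`, set to `0` on `(−∞,0)`. -/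
noncomputable def resolventSnd (f : ℝ → ℝ) (t : ℝ) : ℝ :=
  if t < 0 then 0 else ∑' k : ℕ, convIter f k t

noncomputable def RPi (b c : ℝ) (ν : Measure ℝ) (η θ : ℕ → ℝ) (Λ : ℕ → Measure ℝ)
    (n : ℕ) : ℝ → ℝ :=
  resolventSnd (fun t => gam b c ν η n * piTail c (θ n) (Λ n) t)

noncomputable def Rtwo (b c : ℝ) (ν : Measure ℝ) (η θ : ℕ → ℝ) (Λ : ℕ → Measure ℝ)
    (n : ℕ) (t y : ℝ) : ℝ :=
  if t < 0 ∨ y < 0 then 0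
  else (if t < y then 1 else 0) + ∫ s in (t - y)..t, RPi b c ν η θ Λ n s

section helpers
open ProbabilityTheory
open scoped ENNReal

lemma mgf_exp_hasSum (μ : Measure ℝ) [IsFiniteMeasure μ] (h0 : ∀ᵐ x ∂μ, 0 < x) (t : ℝ) :
    HasSum (fun n : ℕ => t ^ n / n.factorial * ∫ x, Real.exp (-(n * x)) ∂μ)
      (mgf (fun x => Real.exp (-x)) μ t) := by
  have key : ∀ n : ℕ, Integrable (fun x => Real.exp (-(n * x))) μ := fun n => by
    refine Integrable.of_bound (by fun_prop) 1 ?_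
    filter_upwards [h0] with x hx
    rw [Real.norm_eq_abs, abs_of_pos (Real.exp_pos _), Real.exp_le_one_iff]
    have : (0:ℝ) ≤ n * x := by positivity
    linarith
  have hs := hasSum_integral_of_summable_integral_norm (μ := μ)
    (F := fun (n : ℕ) x => t ^ n / n.factorial * Real.exp (-(n * x)))
    (fun n => (key n).const_mul _) ?_
  · have e1 : (fun n : ℕ => t ^ n / n.factorial * ∫ x, Real.exp (-(n * x)) ∂μ) =
        fun n : ℕ => ∫ x, t ^ n / n.factorial * Real.exp (-(n * x)) ∂μ := by
      ext n; rw [integral_const_mul]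
    have e2 : mgf (fun x => Real.exp (-x)) μ t =
        ∫ x, ∑' n : ℕ, t ^ n / n.factorial * Real.exp (-(n * x)) ∂μ := by
      unfold mgf
      apply integral_congr_ae
      filter_upwards with x
      have := NormedSpace.expSeries_div_hasSum_exp (𝔸 := ℝ) (t * Real.exp (-x))
      rw [← Real.exp_eq_exp_ℝ] at this
      rw [← this.tsum_eq]
      congr 1; ext n
      rw [mul_pow, ← Real.exp_nat_mul]; ring_nf
    rw [e1, e2]; exact hs
  · have hsum := (Real.summable_pow_div_factorial |t|).mul_right (μ.real univ)
    refine Summable.of_nonneg_of_le (fun n => by positivity) (fun n => ?_) hsum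
    calc ∫ x, ‖t ^ n / n.factorial * Real.exp (-(n * x))‖ ∂μ
        ≤ ∫ x, |t| ^ n / n.factorial ∂μ := by
          refine integral_mono_ae ((key n).const_mul _).norm (integrable_const _) ?_
          filter_upwards [h0] with x hx
          rw [norm_mul, Real.norm_eq_abs, Real.norm_eq_abs, abs_of_pos (Real.exp_pos _), abs_div,
            abs_pow, Nat.abs_cast]
          refine mul_le_of_le_one_right (by positivity) ?_
          rw [Real.exp_le_one_iff]
          have : (0:ℝ) ≤ n * x := by positivity
          linarith
      _ = _ := by simp [mul_comm]

lemma measure_ext_laplace (μ ρ : Measure ℝ) [IsFiniteMeasure μ] [IsFiniteMeasure ρ]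
    (h0 : ∀ᵐ x ∂μ, 0 < x) (h1 : ∀ᵐ x ∂ρ, 0 < x)
    (h : ∀ n : ℕ, ∫ x, Real.exp (-(n * x)) ∂μ = ∫ x, Real.exp (-(n * x)) ∂ρ) : μ = ρ := by
  set X : ℝ → ℝ := fun x => Real.exp (-x) with hX
  have hXm : Measurable X := by fun_prop
  have hm : mgf X μ = mgf X ρ := by
    ext t
    rw [← (mgf_exp_hasSum μ h0 t).tsum_eq, ← (mgf_exp_hasSum ρ h1 t).tsum_eq]
    congr 1; ext n; rw [h n]
  have hzero : μ = 0 ↔ ρ = 0 := by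
    have := h 0
    simp at this
    rw [← Measure.measure_univ_eq_zero, ← Measure.measure_univ_eq_zero,
      ← measureReal_eq_zero_iff, ← measureReal_eq_zero_iff, this]
  have hset : ∀ t, t ∈ integrableExpSet X μ := fun t => by
    refine Integrable.of_bound (by fun_prop) (Real.exp |t|) ?_
    filter_upwards [h0] with x hx
    rw [Real.norm_eq_abs, abs_of_pos (Real.exp_pos _), Real.exp_le_exp]
    have : X x ≤ 1 := by simp [hX, hx.le]
    have h3 : 0 < X x := Real.exp_pos _
    calc t * X x ≤ |t| * X x := by gcongr; exact le_abs_self t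
      _ ≤ |t| := mul_le_of_le_one_right (abs_nonneg _) this
  have huniv : integrableExpSet X μ = univ := by ext t; simp [hset t]
  have hc : complexMGF X μ = complexMGF X ρ := by
    ext z
    exact eqOn_complexMGF_of_mgf' hm hzero (by simp [huniv])
  have hmap : μ.map X = ρ.map X :=
    Measure.ext_of_complexMGF_eq hXm.aemeasurable hXm.aemeasurable hc
  have hinv : (fun y => -Real.log y) ∘ X = id := by ext x; simp [hX]
  have hl : Measurable (fun y => -Real.log y) := by fun_prop
  have := congrArg (fun m => Measure.map (fun y => -Real.log y) m) hmap
  simpa [Measure.map_map hl hXm, hinv] using this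

lemma lerch (A B : ℝ → ℝ≥0∞) (hA : Measurable A) (hB : Measurable B)
    (hfin : ∀ l : ℝ, 0 < l → ∫⁻ x in Ioi (0:ℝ), ENNReal.ofReal (Real.exp (-l * x)) * A x ≠ ⊤)
    (h : ∀ l : ℝ, 0 < l → ∫⁻ x in Ioi (0:ℝ), ENNReal.ofReal (Real.exp (-l * x)) * A x
      = ∫⁻ x in Ioi (0:ℝ), ENNReal.ofReal (Real.exp (-l * x)) * B x) :
    ∀ᵐ x ∂(volume.restrict (Ioi (0:ℝ))), A x = B x := by
  have hw : ∀ C : ℝ → ℝ≥0∞, Measurable C → 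
      Measurable (fun x => ENNReal.ofReal (Real.exp (-1 * x)) * C x) := fun C hC => by fun_prop
  have hkey : ∀ C : ℝ → ℝ≥0∞, Measurable C → ∀ n : ℕ,
      ∫ x, Real.exp (-(n * x)) ∂((volume.restrict (Ioi (0:ℝ))).withDensity 
        (fun x => ENNReal.ofReal (Real.exp (-1 * x)) * C x)) = 
      (∫⁻ x in Ioi (0:ℝ), ENNReal.ofReal (Real.exp (-(n+1) * x)) * C x).toReal := by
    intro C hC n
    rw [integral_eq_lintegral_of_nonneg_ae (Eventually.of_forall fun x => (Real.exp_pos _).le)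
      (by fun_prop)]
    rw [lintegral_withDensity_eq_lintegral_mul _ (hw C hC) (by fun_prop)]
    congr 1
    apply lintegral_congr
    intro x
    simp only [Pi.mul_apply]
    rw [mul_right_comm, ← ENNReal.ofReal_mul (Real.exp_pos _).le, ← Real.exp_add]
    ring_nf
  have hf : ∀ C : ℝ → ℝ≥0∞, 
      ∫⁻ x in Ioi (0:ℝ), ENNReal.ofReal (Real.exp (-1 * x)) * C x ≠ ⊤ → 
      IsFiniteMeasure ((volume.restrict (Ioi (0:ℝ))).withDensity 
        (fun x => ENNReal.ofReal (Real.exp (-1 * x)) * C x)) := fun C hC =>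
    isFiniteMeasure_withDensity hC
  have hp : ∀ C : ℝ → ℝ≥0∞, ∀ᵐ x ∂((volume.restrict (Ioi (0:ℝ))).withDensity 
        (fun x => ENNReal.ofReal (Real.exp (-1 * x)) * C x)), 0 < x := fun C =>
    (withDensity_absolutelyContinuous _ _).ae_le (ae_restrict_mem measurableSet_Ioi)
  have f1 := hfin 1 one_pos
  have f2 := f1
  rw [h 1 one_pos] at f2
  have := hf A f1
  have := hf B f2
  have := measure_ext_laplace _ _ (hp A) (hp B) (fun n => by
    rw [hkey A hA, hkey B hB, h _ (by positivity)])
  rw [withDensity_eq_iff (hw A hA).aemeasurable (hw B hB).aemeasurable f1] at this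
  filter_upwards [this] with x hx
  have h1 : ENNReal.ofReal (Real.exp (-1 * x)) ≠ 0 := by simp [Real.exp_pos]
  exact (ENNReal.mul_right_inj h1 ENNReal.ofReal_ne_top).1 hx


lemma lapConv (A B : ℝ → ℝ≥0∞) (hA : Measurable A) (hB : Measurable B) (l : ℝ) :
    ∫⁻ t in Ioi (0:ℝ), ENNReal.ofReal (Real.exp (-l * t)) * ∫⁻ s in Ioo 0 t, A (t - s) * B s =
    (∫⁻ t in Ioi (0:ℝ), ENNReal.ofReal (Real.exp (-l * t)) * A t) *
    (∫⁻ t in Ioi (0:ℝ), ENNReal.ofReal (Real.exp (-l * t)) * B t) := by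
  set a : ℝ → ℝ≥0∞ := (Ioi (0:ℝ)).indicator (fun t => ENNReal.ofReal (Real.exp (-l * t)) * A t)
    with ha
  set b : ℝ → ℝ≥0∞ := (Ioi (0:ℝ)).indicator (fun t => ENNReal.ofReal (Real.exp (-l * t)) * B t)
    with hb
  have ham : Measurable a := Measurable.indicator (by fun_prop) measurableSet_Ioi
  have hbm : Measurable b := Measurable.indicator (by fun_prop) measurableSet_Ioi
  rw [← lintegral_indicator measurableSet_Ioi, ← lintegral_indicator measurableSet_Ioi,
    ← lintegral_indicator measurableSet_Ioi]
  have e1 : ∀ t, (Ioi (0:ℝ)).indicator (fun t => ENNReal.ofReal (Real.exp (-l * t)) *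
      ∫⁻ s in Ioo 0 t, A (t - s) * B s) t = ∫⁻ s, a (t - s) * b s := by
    intro t
    by_cases ht : 0 < t
    · rw [indicator_of_mem (mem_Ioi.2 ht), ← lintegral_indicator measurableSet_Ioo,
        ← lintegral_const_mul _ (Measurable.indicator (by fun_prop) measurableSet_Ioo)]
      apply lintegral_congr
      intro s
      by_cases hs : s ∈ Ioo 0 t
      · rw [indicator_of_mem hs, ha, hb, indicator_of_mem (by simpa using hs.2),
          indicator_of_mem (by simpa using hs.1)]
        rw [mul_mul_mul_comm, ← ENNReal.ofReal_mul (Real.exp_pos _).le, ← Real.exp_add]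
        ring_nf
      · rw [indicator_of_notMem hs, mul_zero]
        by_cases h0 : 0 < s
        · have : ¬ (0 < t - s) := fun h => hs ⟨h0, by linarith⟩
          rw [ha, indicator_of_notMem (by simpa using this), zero_mul]
        · rw [hb, indicator_of_notMem (by simpa using h0), mul_zero]
    · rw [indicator_of_notMem (by simpa using ht)]
      symm
      rw [lintegral_eq_zero_iff (by fun_prop)]
      refine Eventually.of_forall fun s => ?_
      by_cases h0 : 0 < s
      · have : ¬ (0 < t - s) := fun h => ht (by linarith)
        simp [ha, indicator_of_notMem (show t - s ∉ Ioi (0:ℝ) from this)]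
      · simp [hb, indicator_of_notMem (show s ∉ Ioi (0:ℝ) from h0)]
  rw [lintegral_congr e1, lintegral_lintegral_swap (by fun_prop)]
  have e2 : ∀ s, ∫⁻ t, a (t - s) * b s = (∫⁻ t, a t) * b s := fun s => by
    rw [lintegral_mul_const _ (by fun_prop), lintegral_sub_right_eq_self]
  rw [lintegral_congr e2, lintegral_const_mul _ hbm]

section nu
variable {ν : Measure ℝ} 

noncomputable def JJ (ν : Measure ℝ) (s : ℝ) : ℝ≥0∞ := ∫⁻ y in Ioi s, ν (Ici y)

lemma nu_Ici_lt_top (hνint : ∫⁻ y in Set.Ioi (0 : ℝ), ENNReal.ofReal (min y (y ^ 2)) ∂ν ≠ ⊤)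
    {y : ℝ} (hy : 0 < y) : ν (Ici y) < ⊤ := by
  have h1 : ENNReal.ofReal (min y (y^2)) * ν (Ici y) ≤
      ∫⁻ y in Set.Ioi (0 : ℝ), ENNReal.ofReal (min y (y ^ 2)) ∂ν := by
    calc ENNReal.ofReal (min y (y^2)) * ν (Ici y) 
        = ∫⁻ x in Ici y, ENNReal.ofReal (min y (y ^ 2)) ∂ν := by simp
      _ ≤ ∫⁻ x in Ici y, ENNReal.ofReal (min x (x ^ 2)) ∂ν := by
          refine setLIntegral_mono (by fun_prop) fun x hx => ENNReal.ofReal_le_ofReal ?_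
          have : y ≤ x := hx
          gcongr
      _ ≤ _ := lintegral_mono_set (fun x hx => lt_of_lt_of_le hy hx)
  have h2 : ENNReal.ofReal (min y (y^2)) ≠ 0 := by
    simp only [ne_eq, ENNReal.ofReal_eq_zero, not_le]; positivity
  by_contra h
  rw [not_lt, top_le_iff] at h
  rw [h, ENNReal.mul_top h2] at h1
  exact hνint (top_le_iff.1 h1)

lemma nu_sigmaFinite (hν0 : ν (Set.Iic 0) = 0)
    (hνint : ∫⁻ y in Set.Ioi (0 : ℝ), ENNReal.ofReal (min y (y ^ 2)) ∂ν ≠ ⊤) : SigmaFinite ν := by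
  refine ⟨⟨⟨fun n : ℕ => Iic 0 ∪ Ici (1 / ((n:ℝ) + 1)), fun _ => trivial, fun n => ?_, ?_⟩⟩⟩
  · refine (measure_union_le _ _).trans_lt ?_
    rw [hν0, zero_add]
    exact nu_Ici_lt_top hνint (by positivity)
  · rw [eq_univ_iff_forall]
    intro x
    rw [mem_iUnion]
    by_cases hx : x ≤ 0
    · exact ⟨0, Or.inl hx⟩
    · obtain ⟨n, hn⟩ := exists_nat_one_div_lt (not_le.1 hx)
      exact ⟨n, Or.inr hn.le⟩

lemma JJ_eq [SigmaFinite ν] (s : ℝ) : JJ ν s = ∫⁻ x, ENNReal.ofReal (x - s) ∂ν := by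
  unfold JJ
  rw [← lintegral_indicator measurableSet_Ioi]
  have hS : MeasurableSet {p : ℝ × ℝ | s < p.1 ∧ p.1 ≤ p.2} :=
    (measurableSet_lt measurable_const measurable_fst).inter
      (measurableSet_le measurable_fst measurable_snd)
  have e1 : ∀ y, (Ioi s).indicator (fun y => ν (Ici y)) y =
      ∫⁻ x, ({p : ℝ × ℝ | s < p.1 ∧ p.1 ≤ p.2}.indicator (fun _ => (1:ℝ≥0∞)) (y, x)) ∂ν := by
    intro y
    by_cases hy : s < y
    · rw [indicator_of_mem (mem_Ioi.2 hy)]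
      have : ∀ x, ({p : ℝ × ℝ | s < p.1 ∧ p.1 ≤ p.2}.indicator (fun _ => (1:ℝ≥0∞)) (y, x)) =
        (Ici y).indicator (fun _ => 1) x := fun x => by
          simp [indicator, hy]
      rw [lintegral_congr this, lintegral_indicator measurableSet_Ici]; simp
    · rw [indicator_of_notMem (by simpa using hy)]
      simp [indicator, hy]
  rw [lintegral_congr e1, lintegral_lintegral_swap (f := fun y x =>
    ({p : ℝ × ℝ | s < p.1 ∧ p.1 ≤ p.2}.indicator (fun _ => (1:ℝ≥0∞)) (y, x)))
    ((measurable_const.indicator hS).aemeasurable)]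
  apply lintegral_congr
  intro x
  have : ∀ y, ({p : ℝ × ℝ | s < p.1 ∧ p.1 ≤ p.2}.indicator (fun _ => (1:ℝ≥0∞)) (y, x)) =
        (Ioc s x).indicator (fun _ => 1) y := fun y => by
          simp [indicator]
  rw [lintegral_congr this, lintegral_indicator measurableSet_Ioc]; simp

lemma inner_lap {l x : ℝ} (hl : 0 < l) (hx : 0 < x) :
    ∫⁻ s in Ioi (0:ℝ), ENNReal.ofReal (Real.exp (-l * s)) * ENNReal.ofReal (x - s) =
      ENNReal.ofReal ((Real.exp (-l * x) - 1 + l * x) / l ^ 2) := by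
  have h1 : ∫⁻ s in Ioi (0:ℝ), ENNReal.ofReal (Real.exp (-l * s)) * ENNReal.ofReal (x - s) =
      ∫⁻ s in Ioc 0 x, ENNReal.ofReal (Real.exp (-l * s) * (x - s)) := by
    rw [← lintegral_indicator measurableSet_Ioi, ← lintegral_indicator measurableSet_Ioc]
    apply lintegral_congr
    intro s
    by_cases hs : 0 < s
    · rw [indicator_of_mem (mem_Ioi.2 hs), ← ENNReal.ofReal_mul (Real.exp_pos _).le]
      by_cases hx' : s ≤ x
      · rw [indicator_of_mem (show s ∈ Ioc 0 x from ⟨hs, hx'⟩)]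
      · rw [indicator_of_notMem (fun h => hx' h.2)]
        rw [ENNReal.ofReal_eq_zero]
        exact mul_nonpos_of_nonneg_of_nonpos (Real.exp_pos _).le (by linarith)
    · rw [indicator_of_notMem (by simpa using hs), indicator_of_notMem (fun h => hs h.1)]
  rw [h1, ← ofReal_integral_eq_lintegral_ofReal]
  · congr 1
    rw [← intervalIntegral.integral_of_le hx.le]
    rw [intervalIntegral.integral_eq_sub_of_hasDerivAt
      (f := fun s => Real.exp (-l * s) * ((s - x) / l + 1 / l ^ 2))]
    · simp; field_simp; ring
    · intro s _
      have h2 : HasDerivAt (fun s => Real.exp (-l * s)) (Real.exp (-l * s) * (-l * 1)) s :=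
        ((hasDerivAt_id s).const_mul (-l)).exp
      have h3 : HasDerivAt (fun s => (s - x) / l + 1 / l ^ 2) (1 / l) s :=
        (((hasDerivAt_id s).sub_const x).div_const l).add_const _
      have h4 := h2.mul h3
      have h5 : Real.exp (-l * s) * (-l * 1) * ((s - x) / l + 1 / l ^ 2) + Real.exp (-l * s) * (1 / l)
        = Real.exp (-l * s) * (x - s) := by
        field_simp; ring
      rw [h5] at h4
      exact h4
    · exact Continuous.intervalIntegrable (by fun_prop) _ _
  · exact (Continuous.integrableOn_Ioc (by fun_prop))
  · filter_upwards [ae_restrict_mem measurableSet_Ioc] with s hs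
    exact mul_nonneg (Real.exp_pos _).le (by linarith [hs.2])

lemma psi_nonneg (z : ℝ) : 0 ≤ Real.exp (-z) - 1 + z := by
  linarith [Real.add_one_le_exp (-z)]

lemma psi_le {z : ℝ} (hz : 0 ≤ z) : Real.exp (-z) - 1 + z ≤ min z (z ^ 2) := by
  have h1 : Real.exp (-z) ≤ 1 := by simp [hz]
  refine le_min (by linarith) ?_
  by_cases h : z ≤ 1
  · have := Real.abs_exp_sub_one_sub_id_le (x := -z) (by rw [abs_neg, abs_of_nonneg hz]; exact h)
    have := (abs_le.1 this).2
    nlinarith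
  · nlinarith

lemma psi_lint (hνint : ∫⁻ y in Set.Ioi (0 : ℝ), ENNReal.ofReal (min y (y ^ 2)) ∂ν ≠ ⊤)
    {l : ℝ} (hl : 0 < l) :
    ∫⁻ x in Ioi (0:ℝ), ENNReal.ofReal (Real.exp (-l * x) - 1 + l * x) ∂ν ≠ ⊤ := by
  refine ne_top_of_le_ne_top (ENNReal.mul_ne_top (ENNReal.ofReal_ne_top (r := max l (l^2))) hνint) ?_
  rw [← lintegral_const_mul _ (by fun_prop)]
  refine setLIntegral_mono (by fun_prop) fun x hx => ?_
  have hx : 0 < x := hx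
  rw [← ENNReal.ofReal_mul (by positivity)]
  apply ENNReal.ofReal_le_ofReal
  have := psi_le (z := l * x) (by positivity)
  rw [neg_mul]
  refine this.trans ?_
  rw [mul_min_of_nonneg _ _ (by positivity)]
  refine min_le_min ?_ ?_
  · gcongr; exact le_max_left _ _
  · rw [mul_pow]; gcongr; exact le_max_right _ _

lemma lapJ (b c : ℝ) (hν0 : ν (Set.Iic 0) = 0)
    (hνint : ∫⁻ y in Set.Ioi (0 : ℝ), ENNReal.ofReal (min y (y ^ 2)) ∂ν ≠ ⊤)
    {l : ℝ} (hl : 0 < l) :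
    ∫⁻ s in Ioi (0:ℝ), ENNReal.ofReal (Real.exp (-l * s)) * JJ ν s =
      ENNReal.ofReal ((phi b c ν l - b * l - c * l ^ 2) / l ^ 2) := by
  have := nu_sigmaFinite hν0 hνint
  have e0 : ∀ s, ENNReal.ofReal (Real.exp (-l * s)) * JJ ν s = 
    ∫⁻ x, ENNReal.ofReal (Real.exp (-l * s)) * ENNReal.ofReal (x - s) ∂ν := fun s => by
      rw [JJ_eq, lintegral_const_mul _ (by fun_prop)]
  rw [lintegral_congr e0, lintegral_lintegral_swap (by fun_prop)]
  have hnu : ν.restrict (Ioi 0) = ν := by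
    rw [Measure.restrict_eq_self_of_ae_mem]
    rw [ae_iff]; convert hν0 using 2; ext x; simp
  have e1 : ∫⁻ x, (∫⁻ s in Ioi (0:ℝ), ENNReal.ofReal (Real.exp (-l * s)) * ENNReal.ofReal (x - s)) ∂ν
    = ∫⁻ x in Ioi (0:ℝ), ENNReal.ofReal ((Real.exp (-l * x) - 1 + l * x)) * ENNReal.ofReal (1 / l^2) ∂ν := by
    conv_lhs => rw [← hnu]
    refine setLIntegral_congr_fun measurableSet_Ioi fun x hx => ?_
    rw [inner_lap hl hx, ← ENNReal.ofReal_mul', div_eq_mul_one_div]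
    positivity
  rw [e1, lintegral_mul_const _ (by fun_prop)]
  have e2 : phi b c ν l - b * l - c * l ^ 2 = 
      (∫⁻ x in Ioi (0:ℝ), ENNReal.ofReal (Real.exp (-l * x) - 1 + l * x) ∂ν).toReal := by
    rw [phi, integral_eq_lintegral_of_nonneg_ae]
    · ring
    · exact Eventually.of_forall fun x => by simpa using psi_nonneg (l * x)
    · fun_prop
  rw [e2, div_eq_mul_one_div (ENNReal.toReal _), ENNReal.ofReal_mul ENNReal.toReal_nonneg, ENNReal.ofReal_toReal]
  exact psi_lint hνint hl

lemma JJ_anti : Antitone (JJ ν) := fun _ _ h => lintegral_mono_set (Ioi_subset_Ioi h)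

lemma JJ_lt_top (hν0 : ν (Set.Iic 0) = 0)
    (hνint : ∫⁻ y in Set.Ioi (0 : ℝ), ENNReal.ofReal (min y (y ^ 2)) ∂ν ≠ ⊤)
    {s : ℝ} (hs : 0 < s) : JJ ν s < ⊤ := by
  by_contra h
  rw [not_lt, top_le_iff] at h
  have h1 := lapJ 0 0 hν0 hνint one_pos
  have h2 : ∫⁻ t in Ioo 0 s, (⊤:ℝ≥0∞) ≤ 
      ∫⁻ s in Ioi (0:ℝ), ENNReal.ofReal (Real.exp (-1 * s)) * JJ ν s := by
    refine (setLIntegral_mono' measurableSet_Ioo fun t ht => ?_).trans 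
      (lintegral_mono_set Ioo_subset_Ioi_self)
    have : JJ ν t = ⊤ := top_le_iff.1 (h ▸ JJ_anti ht.2.le)
    rw [this, ENNReal.mul_top]
    simp [Real.exp_pos]
  rw [h1] at h2
  rw [lintegral_const, ENNReal.top_mul (by simp [hs])] at h2
  exact ENNReal.ofReal_ne_top (top_le_iff.1 h2)

lemma tail_meas : Measurable (fun y => ν (Ici y)) :=
  (show Antitone (fun y => ν (Ici y)) from fun _ _ h => measure_mono (Ici_subset_Ici.2 h)).measurable

lemma tailNu_meas : Measurable (tailNu ν) := tail_meas.ennreal_toReal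

lemma tailNu_nonneg (y : ℝ) : 0 ≤ tailNu ν y := ENNReal.toReal_nonneg

lemma tailNu_integrableOn_of {s : ℝ} (h : JJ ν s < ⊤) : IntegrableOn (tailNu ν) (Ioi s) :=
  integrable_toReal_of_lintegral_ne_top tail_meas.aemeasurable h.ne

lemma itailNu_eq {s : ℝ} (h : ∀ y, s < y → ν (Ici y) < ⊤) : itailNu ν s = (JJ ν s).toReal := by
  unfold itailNu JJ tailNu
  rw [integral_toReal tail_meas.aemeasurable]
  filter_upwards [ae_restrict_mem measurableSet_Ioi] with y hy using h y hy

lemma tailNu_anti {x y : ℝ} (hx : ν (Ici x) < ⊤) (hxy : x ≤ y) : tailNu ν y ≤ tailNu ν x :=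
  ENNReal.toReal_mono hx.ne (measure_mono (Ici_subset_Ici.2 hxy))
end nu


lemma lapOne {l : ℝ} (hl : 0 < l) :
    ∫⁻ x in Ioi (0:ℝ), ENNReal.ofReal (Real.exp (-l * x)) = ENNReal.ofReal (1 / l) := by
  rw [← ofReal_integral_eq_lintegral_ofReal]
  · rw [integral_exp_mul_Ioi (by linarith)]; congr 1; simp
  · exact integrableOn_exp_mul_Ioi (by linarith) 0
  · exact Eventually.of_forall fun x => (Real.exp_pos _).le

lemma phi_ge {b c : ℝ} {ν : Measure ℝ} (hb : 0 ≤ b) {l : ℝ} (hl : 0 < l) :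
    b * l + c * l ^ 2 ≤ phi b c ν l := by
  unfold phi
  have : 0 ≤ ∫ y in Set.Ioi (0 : ℝ), (Real.exp (-l * y) - 1 + l * y) ∂ν :=
    integral_nonneg fun y => by simpa using psi_nonneg (l * y)
  linarith

lemma conv_meas (A B : ℝ → ℝ≥0∞) (hA : Measurable A) (hB : Measurable B) :
    Measurable (fun t : ℝ => ∫⁻ s in Ioo 0 t, A (t - s) * B s) := by
  have : ∀ t : ℝ, ∫⁻ s in Ioo 0 t, A (t - s) * B s = ∫⁻ s,
      {p : ℝ × ℝ | 0 < p.2 ∧ p.2 < p.1}.indicator (fun p => A (p.1 - p.2) * B p.2) (t, s) := by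
    intro t
    rw [← lintegral_indicator measurableSet_Ioo]
    rfl
  simp_rw [this]
  apply Measurable.lintegral_prod_right'
  refine Measurable.indicator (by fun_prop) ?_
  exact (measurableSet_lt measurable_const measurable_snd).inter
      (measurableSet_lt measurable_snd measurable_fst)

lemma W_volterra
    (b c : ℝ) (hb : 0 ≤ b) (hc : 0 < c)
    (ν : Measure ℝ) (hν0 : ν (Set.Iic 0) = 0)
    (hνint : ∫⁻ y in Set.Ioi (0 : ℝ), ENNReal.ofReal (min y (y ^ 2)) ∂ν ≠ ⊤)
    (W W' : ℝ → ℝ)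
    (hWnonneg : ∀ x : ℝ, 0 ≤ W x)
    (hWcont : ContinuousOn W (Set.Ici 0))
    (hWmono : StrictMonoOn W (Set.Ici 0))
    (hWlap : ∀ l : ℝ, 0 < l →
      (∫ x in Set.Ioi (0 : ℝ), Real.exp (-l * x) * W x) = 1 / phi b c ν l)
    (hW'zero : W' 0 = 1 / c)
    (hW'deriv : ∀ x : ℝ, 0 < x → HasDerivAt W (W' x) x)
    (hW'cont : ContinuousOn W' (Set.Ici 0)) :
    ∃ V : ℝ → ℝ, Continuous V ∧ (∀ t, 0 ≤ t → V t = W' t) ∧ (∀ t, 0 ≤ V t) ∧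
      (∀ t, V t ≤ 1 / c) ∧ ∀ᵐ t ∂(volume.restrict (Ioi (0:ℝ))),
        c * V t + ∫ s in (0:ℝ)..t, (b + itailNu ν (t - s)) * V s = 1 := by
  have hW'nn : ∀ t, 0 ≤ t → 0 ≤ W' t := by
    intro t ht
    rcases ht.eq_or_lt with rfl | ht
    · rw [hW'zero]; positivity
    · have := (hW'deriv t ht).hasDerivWithinAt (s := Ioi 0)
      refine this.nonneg_of_monotoneOn ?_ (hWmono.monotoneOn.mono Ioi_subset_Ici_self)
      exact uniqueDiffWithinAt_iff_accPt.1 (isOpen_Ioi.uniqueDiffWithinAt ht)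
  set V : ℝ → ℝ := fun t => W' (max t 0) with hV
  have hVc : Continuous V := by
    rw [← continuousOn_univ]
    exact hW'cont.comp (by fun_prop) (fun t _ => le_max_right t 0)
  have hVeq : ∀ t, 0 ≤ t → V t = W' t := fun t ht => by simp [hV, ht]
  have hVnn : ∀ t, 0 ≤ V t := fun t => hW'nn _ (le_max_right _ _)
  have hphi : ∀ l, 0 < l → 0 < phi b c ν l := fun l hl =>
    lt_of_lt_of_le (by positivity) (phi_ge hb hl)
  -- Laplace transform of W
  have hWl : ∀ l, 0 < l → ∫⁻ x in Ioi (0:ℝ), ENNReal.ofReal (Real.exp (-l * x)) *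
      ENNReal.ofReal (W x) = ENNReal.ofReal (1 / phi b c ν l) := by
    intro l hl
    have hi : IntegrableOn (fun x => Real.exp (-l * x) * W x) (Ioi 0) := by
      by_contra h
      have h1 := hWlap l hl
      rw [integral_undef h] at h1
      have := hphi l hl
      have : 0 < 1 / phi b c ν l := by positivity
      linarith
    rw [← hWlap l hl, ofReal_integral_eq_lintegral_ofReal hi]
    · simp_rw [ENNReal.ofReal_mul (Real.exp_pos _).le]
    · exact Eventually.of_forall fun x => mul_nonneg (Real.exp_pos _).le (hWnonneg x)
  have hW0 : W 0 = 0 := by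
    have h1 : ∀ l, 0 < l → W 0 ≤ 1 / (c * l) := by
      intro l hl
      have h2 : ENNReal.ofReal (1 / l) * ENNReal.ofReal (W 0) ≤ ENNReal.ofReal (1 / phi b c ν l) := by
        rw [← hWl l hl, ← lapOne hl, ← lintegral_mul_const _ (by fun_prop)]
        refine setLIntegral_mono' measurableSet_Ioi fun x hx => ?_
        gcongr
        exact hWmono.monotoneOn (self_mem_Ici) (mem_Ici.2 (le_of_lt hx)) (le_of_lt hx)
      rw [← ENNReal.ofReal_mul (by positivity), ENNReal.ofReal_le_ofReal_iff
        (by have := hphi l hl; positivity)] at h2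
      have h3 : 1 / phi b c ν l ≤ 1 / (c * l ^ 2) := by
        apply one_div_le_one_div_of_le (by positivity)
        have := phi_ge (b := b) (c := c) (ν := ν) hb hl
        have : 0 ≤ b * l := by positivity
        linarith
      have h4 := h2.trans h3
      rw [one_div_mul_eq_div, div_le_div_iff₀ hl (by positivity)] at h4
      rw [le_div_iff₀ (by positivity)]
      have h5 : (W 0 * (c * l)) * l ≤ 1 * l := by nlinarith
      exact le_of_mul_le_mul_right h5 hl
    refine le_antisymm ?_ (hWnonneg 0)
    have ht : Tendsto (fun l : ℝ => 1 / (c * l)) atTop (𝓝 0) := by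
      simp_rw [one_div]
      exact (tendsto_id.const_mul_atTop hc).inv_tendsto_atTop
    exact ge_of_tendsto ht ((eventually_gt_atTop 0).mono h1)
  have hWint : ∀ x, 0 < x → ENNReal.ofReal (W x) = ∫⁻ s in Ioo 0 x, 1 * ENNReal.ofReal (V s) := by
    intro x hx
    have h1 : ∫ s in (0:ℝ)..x, V s = W x - W 0 := by
      refine intervalIntegral.integral_eq_sub_of_hasDerivAt_of_le hx.le
        (hWcont.mono Icc_subset_Ici_self) (fun y hy => ?_) (hVc.intervalIntegrable _ _)
      rw [hVeq y hy.1.le]; exact hW'deriv y hy.1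
    rw [hW0, sub_zero] at h1
    rw [← h1, intervalIntegral.integral_of_le hx.le, integral_Ioc_eq_integral_Ioo]
    simp_rw [one_mul]
    rw [ofReal_integral_eq_lintegral_ofReal]
    · exact (hVc.integrableOn_Ioc (a := 0) (b := x)).mono_set Ioo_subset_Ioc_self
    · exact Eventually.of_forall hVnn
  have hVl : ∀ l, 0 < l → ∫⁻ x in Ioi (0:ℝ), ENNReal.ofReal (Real.exp (-l * x)) *
      ENNReal.ofReal (V x) = ENNReal.ofReal (l / phi b c ν l) := by
    intro l hl
    have h1 := lapConv (fun _ => 1) (fun x => ENNReal.ofReal (V x)) measurable_const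
      (by fun_prop) l
    simp only [mul_one] at h1
    rw [lapOne hl] at h1
    have h2 : ∫⁻ t in Ioi (0:ℝ), ENNReal.ofReal (Real.exp (-l * t)) *
        ∫⁻ s in Ioo 0 t, 1 * ENNReal.ofReal (V s) = ENNReal.ofReal (1 / phi b c ν l) := by
      rw [← hWl l hl]
      refine setLIntegral_congr_fun measurableSet_Ioi fun x hx => ?_
      rw [hWint x hx]
    rw [h2] at h1
    have h3 := congrArg (fun z => ENNReal.ofReal l * z) h1
    rw [← mul_assoc, ← ENNReal.ofReal_mul hl.le, ← ENNReal.ofReal_mul hl.le, mul_one_div_cancel hl.ne',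
      ENNReal.ofReal_one, one_mul] at h3
    rw [← h3, mul_one_div]
  have hJm : Measurable (JJ ν) := JJ_anti.measurable
  set k : ℝ → ℝ≥0∞ := fun t => ENNReal.ofReal b + JJ ν t with hk
  have hkm : Measurable k := by fun_prop
  have hkl : ∀ l, 0 < l → ∫⁻ x in Ioi (0:ℝ), ENNReal.ofReal (Real.exp (-l * x)) * k x =
      ENNReal.ofReal (b / l + (phi b c ν l - b * l - c * l ^ 2) / l ^ 2) := by
    intro l hl
    simp_rw [hk, mul_add]
    rw [lintegral_add_left (by fun_prop), lintegral_mul_const _ (by fun_prop), lapOne hl,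
      lapJ b c hν0 hνint hl, ← ENNReal.ofReal_mul (by positivity), ← ENNReal.ofReal_add]
    · congr 1; ring
    · positivity
    · have := phi_ge (b := b) (c := c) (ν := ν) hb hl
      have : 0 ≤ phi b c ν l - b * l - c * l ^ 2 := by linarith
      positivity
  set A : ℝ → ℝ≥0∞ := fun t => ENNReal.ofReal c * ENNReal.ofReal (V t) +
    ∫⁻ s in Ioo 0 t, k (t - s) * ENNReal.ofReal (V s) with hA
  have hcm := conv_meas k (fun x => ENNReal.ofReal (V x)) hkm (by fun_prop)
  have hAm : Measurable A := by fun_prop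
  have hAl : ∀ l, 0 < l → ∫⁻ x in Ioi (0:ℝ), ENNReal.ofReal (Real.exp (-l * x)) * A x =
      ENNReal.ofReal (1 / l) := by
    intro l hl
    simp_rw [hA, mul_add]
    rw [lintegral_add_left (by fun_prop), lapConv k _ hkm (by fun_prop), hkl l hl, hVl l hl]
    simp_rw [mul_left_comm _ (ENNReal.ofReal c)]
    have hp := hphi l hl
    have h0 : 0 ≤ phi b c ν l - b * l - c * l ^ 2 := by
      linarith [phi_ge (b := b) (c := c) (ν := ν) hb hl]
    rw [lintegral_const_mul _ (by fun_prop), hVl l hl, ← ENNReal.ofReal_mul hc.le,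
      ← ENNReal.ofReal_mul (by positivity), ← ENNReal.ofReal_add (by positivity) (by positivity)]
    congr 1
    field_simp; ring
  have hae := lerch A (fun _ => 1) hAm measurable_const
    (fun l hl => by rw [hAl l hl]; exact ENNReal.ofReal_ne_top)
    (fun l hl => by rw [hAl l hl]; simp only [mul_one]; rw [lapOne hl])
  have hVle0 : ∀ t, 0 ≤ t → V t ≤ 1 / c := by
    intro t ht
    have h1 : (fun t => max (V t) (1 / c)) =ᵐ[volume.restrict (Icc 0 (t+1))] fun _ => 1 / c := by
      have h2 : ∀ᵐ x ∂(volume.restrict (Icc 0 (t+1))), A x = 1 := by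
        rw [← restrict_Ioo_eq_restrict_Icc]
        exact ae_restrict_of_ae_restrict_of_subset Ioo_subset_Ioi_self hae
      filter_upwards [h2] with x hx
      rw [max_eq_right]
      have h3 : ENNReal.ofReal c * ENNReal.ofReal (V x) ≤ 1 := by
        rw [← hx]; exact le_self_add
      rw [← ENNReal.ofReal_mul hc.le, ← ENNReal.ofReal_one, ENNReal.ofReal_le_ofReal_iff one_pos.le] at h3
      rw [le_div_iff₀ hc]; linarith
    have h4 := Measure.eqOn_Icc_of_ae_eq volume (by linarith : (0:ℝ) ≠ t + 1) h1 (by fun_prop) (by fun_prop)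
    have h5 := h4 (⟨ht, by linarith⟩ : t ∈ Icc 0 (t+1))
    simp only at h5
    rw [← h5]; exact le_max_left _ _
  refine ⟨V, hVc, hVeq, hVnn, fun t => ?_, ?_⟩
  · have := hVle0 (max t 0) (le_max_right _ _)
    simpa [hV] using this
  · filter_upwards [hae, ae_restrict_mem measurableSet_Ioi] with t ht ht0
    have ht0 : 0 < t := ht0
    have h1 : ∫ s in (0:ℝ)..t, (b + itailNu ν (t - s)) * V s =
        (∫⁻ s in Ioo 0 t, k (t - s) * ENNReal.ofReal (V s)).toReal := by
      rw [intervalIntegral.integral_of_le ht0.le, integral_Ioc_eq_integral_Ioo,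
        ← integral_toReal (by fun_prop)]
      · refine setIntegral_congr_fun measurableSet_Ioo fun s hs => ?_
        have hs' : 0 < t - s := by linarith [hs.2]
        simp only [hk]
        rw [ENNReal.toReal_mul, ENNReal.toReal_add ENNReal.ofReal_ne_top
          (JJ_lt_top hν0 hνint hs').ne, ENNReal.toReal_ofReal hb, ENNReal.toReal_ofReal (hVnn s),
          itailNu_eq (fun y hy => nu_Ici_lt_top hνint (hs'.trans hy))]
      · filter_upwards [ae_restrict_mem measurableSet_Ioo] with s hs
        have hs' : 0 < t - s := by linarith [hs.2]
        exact ENNReal.mul_lt_top (ENNReal.add_lt_top.2 ⟨ENNReal.ofReal_lt_top,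
          JJ_lt_top hν0 hνint hs'⟩) ENNReal.ofReal_lt_top
    rw [h1]
    have h2 := congrArg ENNReal.toReal ht
    simp only [hA] at h2 ht
    rw [ENNReal.toReal_add, ENNReal.toReal_mul, ENNReal.toReal_ofReal hc.le,
      ENNReal.toReal_ofReal (hVnn t), ENNReal.toReal_one] at h2
    · exact h2
    · exact ENNReal.mul_ne_top ENNReal.ofReal_ne_top ENNReal.ofReal_ne_top
    · exact ne_top_of_le_ne_top ENNReal.one_ne_top (ht ▸ le_add_self)


lemma convPos_cont (F G : ℝ → ℝ) (hF : Continuous F) (hG : Continuous G) :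
    Continuous (convPos F G) := by
  unfold convPos
  exact intervalIntegral.continuous_parametric_intervalIntegral_of_continuous
    (f := fun x y => F (x - y) * G y) (by fun_prop) continuous_id

lemma convIter_cont (F : ℝ → ℝ) (hF : Continuous F) (k : ℕ) : Continuous (convIter F k) := by
  induction k with
  | zero => exact hF
  | succ k ih => exact convPos_cont F _ hF ih

lemma convIter_congr (f F : ℝ → ℝ) (h : ∀ t, 0 ≤ t → f t = F t) (k : ℕ) :
    ∀ t, 0 ≤ t → convIter f k t = convIter F k t := by
  induction k with
  | zero => exact h
  | succ k ih =>
    intro t ht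
    simp only [convIter, convPos]
    apply intervalIntegral.integral_congr
    intro s hs
    rw [uIcc_of_le ht] at hs
    simp only
    rw [h _ (by linarith [hs.2]), ih _ hs.1]

lemma convIter_bound (F : ℝ → ℝ) (T C : ℝ) (hC : ∀ t ∈ Icc 0 T, |F t| ≤ C) (k : ℕ) :
    ∀ t ∈ Icc 0 T, |convIter F k t| ≤ C ^ (k + 1) * t ^ k / k.factorial := by
  induction k with
  | zero => intro t ht; simpa [convIter] using hC t ht
  | succ k ih =>
    intro t ht
    have hC0 : 0 ≤ C := (abs_nonneg _).trans (hC t ht)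
    simp only [convIter, convPos]
    have h1 : ∀ᵐ s, s ∈ Ioc 0 t → ‖F (t - s) * convIter F k s‖ ≤
        (C ^ (k + 2) / k.factorial) * s ^ k := by
      refine Eventually.of_forall fun s hs => ?_
      rw [norm_mul, Real.norm_eq_abs, Real.norm_eq_abs]
      have a1 := hC (t - s) ⟨by linarith [hs.2], by linarith [hs.1, ht.2]⟩
      have a2 := ih s ⟨hs.1.le, hs.2.trans ht.2⟩
      calc |F (t - s)| * |convIter F k s| ≤ C * (C ^ (k + 1) * s ^ k / k.factorial) := by gcongr
        _ = _ := by ring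
    have h2 := intervalIntegral.norm_integral_le_of_norm_le ht.1 h1
      (Continuous.intervalIntegrable (by fun_prop) _ _)
    rw [Real.norm_eq_abs] at h2
    refine h2.trans (le_of_eq ?_)
    rw [intervalIntegral.integral_const_mul, integral_pow, Nat.factorial_succ]
    push_cast
    field_simp
    simp

lemma resolvent_exists (f F : ℝ → ℝ) (hF : Continuous F) (h : ∀ t, 0 ≤ t → f t = F t) :
    ∃ R : ℝ → ℝ, Continuous R ∧ (∀ t, 0 ≤ t → resolventSnd f t = R t) ∧
      ∀ t, 0 ≤ t → R t = F t + ∫ s in (0:ℝ)..t, F (t - s) * R s := by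
  set R : ℝ → ℝ := fun t => ∑' k, convIter F k (max t 0) with hR
  have hbd : ∀ T, 0 ≤ T → ∃ u : ℕ → ℝ, Summable u ∧
      ∀ k t, t ≤ T → |convIter F k (max t 0)| ≤ u k := by
    intro T hT
    obtain ⟨C, hC⟩ := isCompact_Icc.exists_bound_of_continuousOn
      (hF.continuousOn (s := Icc 0 T))
    have hC0 : 0 ≤ C := (norm_nonneg _).trans (hC 0 ⟨le_rfl, hT⟩)
    refine ⟨fun k => C * ((C * T) ^ k / k.factorial),
      (Real.summable_pow_div_factorial _).mul_left _, fun k t ht => ?_⟩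
    have h0 : 0 ≤ max t 0 := le_max_right _ _
    have h1 : max t 0 ≤ T := max_le ht hT
    refine (convIter_bound F T C (fun t ht => hC t ht) k _ ⟨h0, h1⟩).trans ?_
    calc C ^ (k + 1) * max t 0 ^ k / k.factorial ≤ C ^ (k + 1) * T ^ k / k.factorial := by gcongr
      _ = C * ((C * T) ^ k / k.factorial) := by rw [mul_pow]; ring
  have hcont : ∀ k, Continuous (fun t => convIter F k (max t 0)) := fun k =>
    (convIter_cont F hF k).comp (by fun_prop)
  have hRc : Continuous R := by
    rw [continuous_iff_continuousAt]
    intro t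
    obtain ⟨u, hu, hb⟩ := hbd (|t| + 1) (by positivity)
    have : ContinuousOn R (Iic (|t| + 1)) :=
      continuousOn_tsum (fun k => (hcont k).continuousOn) hu (fun k t ht => hb k t ht)
    exact this.continuousAt (Iic_mem_nhds (by linarith [le_abs_self t]))
  refine ⟨R, hRc, fun t ht => ?_, fun t ht => ?_⟩
  · simp only [resolventSnd, not_lt.2 ht, if_false, hR]
    rw [max_eq_left ht]
    congr 1; ext k; exact convIter_congr f F h k t ht
  · obtain ⟨u, hu, hb⟩ := hbd t ht
    have hs : Summable (fun k => convIter F k (max t 0)) :=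
      Summable.of_norm_bounded hu (fun k => hb k t le_rfl)
    have h1 : R t = F t + ∑' k, convIter F (k + 1) t := by
      simp only [hR]
      rw [hs.tsum_eq_zero_add, max_eq_left ht]; rfl
    obtain ⟨C, hC⟩ := isCompact_Icc.exists_bound_of_continuousOn
      (hF.continuousOn (s := Icc 0 t))
    have hC0 : 0 ≤ C := (norm_nonneg _).trans (hC 0 ⟨le_rfl, ht⟩)
    have h2 : HasSum (fun k => ∫ s in (0:ℝ)..t, F (t - s) * convIter F k s)
        (∫ s in (0:ℝ)..t, F (t - s) * R s) := by
      refine intervalIntegral.hasSum_integral_of_dominated_convergence (fun k _ => C * u k)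
        (fun k => ?_) (fun k => ?_) ?_ ?_ ?_
      · have := convIter_cont F hF k
        exact Continuous.aestronglyMeasurable (by fun_prop)
      · refine Eventually.of_forall fun s hs => ?_
        rw [uIoc_of_le ht] at hs
        rw [norm_mul]
        have a1 := hC (t - s) ⟨by linarith [hs.2], by linarith [hs.1]⟩
        have a2 := hb k s hs.2
        rw [max_eq_left hs.1.le, ← Real.norm_eq_abs] at a2
        gcongr
      · exact Eventually.of_forall fun s _ => hu.mul_left _
      · exact intervalIntegrable_const
      · refine Eventually.of_forall fun s hs => ?_
        rw [uIoc_of_le ht] at hs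
        have hs' : Summable (fun k => convIter F k (max s 0)) :=
          Summable.of_norm_bounded hu (fun k => hb k s hs.2)
        have := hs'.hasSum.mul_left (F (t - s))
        simp only [max_eq_left hs.1.le] at this
        simp only [hR, max_eq_left hs.1.le]
        exact this
    rw [h1, ← h2.tsum_eq]; rfl

lemma fubini_triangle (F R : ℝ → ℝ) (hF : Continuous F) (hR : Continuous R) {t : ℝ} (ht : 0 ≤ t) :
    ∫ u in (0:ℝ)..t, ∫ s in (0:ℝ)..u, F (u - s) * R s =
    ∫ s in (0:ℝ)..t, (∫ v in (0:ℝ)..(t - s), F v) * R s := by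
  set D : Set (ℝ × ℝ) := {p | p.2 ≤ p.1} with hD
  have hDm : MeasurableSet D := measurableSet_le measurable_snd measurable_fst
  set g : ℝ × ℝ → ℝ := D.indicator (fun p => F (p.1 - p.2) * R p.2) with hg
  have hI : Integrable g ((volume.restrict (Ioc 0 t)).prod (volume.restrict (Ioc 0 t))) := by
    rw [Measure.prod_restrict]
    refine Integrable.indicator ?_ hDm
    have : IntegrableOn (fun p : ℝ × ℝ => F (p.1 - p.2) * R p.2) (Icc 0 t ×ˢ Icc 0 t)
        (volume.prod volume) :=
      ContinuousOn.integrableOn_compact (isCompact_Icc.prod isCompact_Icc)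
        (Continuous.continuousOn (by fun_prop))
    exact this.mono_set (prod_mono Ioc_subset_Icc_self Ioc_subset_Icc_self)
  have hsw := integral_integral_swap (f := fun u s => g (u, s)) hI
  rw [intervalIntegral.integral_of_le ht, intervalIntegral.integral_of_le ht]
  have e1 : ∫ u in Ioc 0 t, ∫ s in (0:ℝ)..u, F (u - s) * R s =
      ∫ u in Ioc 0 t, ∫ s in Ioc 0 t, g (u, s) := by
    refine setIntegral_congr_fun measurableSet_Ioc fun u hu => ?_
    rw [intervalIntegral.integral_of_le hu.1.le]
    have : ∀ s, g (u, s) = (Iic u).indicator (fun s => F (u - s) * R s) s := fun s => by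
      simp [hg, hD, indicator]
    simp_rw [this]
    rw [setIntegral_indicator measurableSet_Iic]
    congr 2
    ext s; simp only [mem_Ioc, mem_inter_iff, mem_Iic]
    constructor
    · rintro ⟨h1, h2⟩; exact ⟨⟨h1, h2.trans hu.2⟩, h2⟩
    · rintro ⟨⟨h1, _⟩, h2⟩; exact ⟨h1, h2⟩
  have e2 : ∫ s in Ioc 0 t, (∫ v in (0:ℝ)..(t - s), F v) * R s =
      ∫ s in Ioc 0 t, ∫ u in Ioc 0 t, g (u, s) := by
    refine setIntegral_congr_fun measurableSet_Ioc fun s hs => ?_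
    have : ∀ u, g (u, s) = (Ici s).indicator (fun u => F (u - s) * R s) u := fun u => by
      simp [hg, hD, indicator]
    simp_rw [this]
    rw [setIntegral_indicator measurableSet_Ici]
    have hset : Ioc 0 t ∩ Ici s = Icc s t := by
      ext u; simp only [mem_Ioc, mem_inter_iff, mem_Ici, mem_Icc]
      constructor
      · rintro ⟨⟨h1, h2⟩, h3⟩; exact ⟨h3, h2⟩
      · rintro ⟨h1, h2⟩; exact ⟨⟨hs.1.trans_le h1, h2⟩, h1⟩
    rw [hset, integral_Icc_eq_integral_Ioc, ← intervalIntegral.integral_of_le hs.2,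
      intervalIntegral.integral_mul_const,
      intervalIntegral.integral_comp_sub_right (fun v => F v), sub_self]
  rw [e1, e2]; exact hsw

lemma resolvent_volterra (F R H : ℝ → ℝ) (c g : ℝ) (hF : Continuous F) (hR : Continuous R)
    (hH : Continuous H)
    (hR2 : ∀ t, 0 ≤ t → R t = F t + ∫ s in (0:ℝ)..t, F (t - s) * R s)
    (hFH : ∀ t, 0 ≤ t → c * F t + ∫ s in (0:ℝ)..t, F s = g + H t) {t : ℝ} (ht : 0 ≤ t) :
    c * R t + ∫ s in (0:ℝ)..t, (1 - g - H (t - s)) * R s = g + H t := by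
  have h1 : ∫ u in (0:ℝ)..t, R u = (∫ u in (0:ℝ)..t, F u) +
      ∫ s in (0:ℝ)..t, (∫ v in (0:ℝ)..(t - s), F v) * R s := by
    rw [← fubini_triangle F R hF hR ht, ← intervalIntegral.integral_add]
    · apply intervalIntegral.integral_congr
      intro u hu
      rw [uIcc_of_le ht] at hu
      exact hR2 u hu.1
    · exact hF.intervalIntegrable _ _
    · exact (convPos_cont F R hF hR).intervalIntegrable _ _
  have h2 : ∫ s in (0:ℝ)..t, (∫ v in (0:ℝ)..(t - s), F v) * R s =
      (∫ s in (0:ℝ)..t, (g + H (t - s)) * R s) - c * ∫ s in (0:ℝ)..t, F (t - s) * R s := by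
    rw [← intervalIntegral.integral_const_mul, ← intervalIntegral.integral_sub]
    · apply intervalIntegral.integral_congr
      intro s hs
      rw [uIcc_of_le ht] at hs
      have := hFH (t - s) (by linarith [hs.2])
      simp only
      rw [show ∫ v in (0:ℝ)..(t - s), F v = g + H (t - s) - c * F (t - s) by linarith]
      ring
    · exact Continuous.intervalIntegrable (by fun_prop) _ _
    · exact Continuous.intervalIntegrable (by fun_prop) _ _
  have h3 : ∫ s in (0:ℝ)..t, (1 - g - H (t - s)) * R s = 
      (∫ s in (0:ℝ)..t, R s) - ∫ s in (0:ℝ)..t, (g + H (t - s)) * R s := by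
    rw [← intervalIntegral.integral_sub]
    · congr 1; ext s; ring
    · exact Continuous.intervalIntegrable (by fun_prop) _ _
    · exact Continuous.intervalIntegrable (by fun_prop) _ _
  have h4 := hR2 t ht
  have h5 := hFH t ht
  rw [h3, h1, h2]
  linear_combination c * h4 + h5


noncomputable def GG (c z : ℝ) : ℝ := Real.exp (-(max z 0) / c)

lemma GG_cont (c : ℝ) : Continuous (GG c) := by unfold GG; fun_prop
lemma GG_pos (c z : ℝ) : 0 < GG c z := Real.exp_pos _
lemma GG_le {c : ℝ} (hc : 0 < c) (z : ℝ) : GG c z ≤ 1 := by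
  unfold GG
  rw [Real.exp_le_one_iff]
  have : 0 ≤ max z 0 / c := by positivity
  rw [neg_div]; linarith

lemma expDens_Ioi {c : ℝ} (hc : 0 < c) (a u : ℝ) :
    IntegrableOn (fun y => expDens c (y - u)) (Ioi a) ∧
    ∫ y in Ioi a, expDens c (y - u) = Real.exp (-(a - u) / c) := by
  have h : (fun y => expDens c (y - u)) =
      fun y => (1 / c * Real.exp (u / c)) * Real.exp (-(1 / c) * y) := by
    ext y
    unfold expDens
    rw [mul_assoc, ← Real.exp_add]; congr 2; field_simp; ring
  have hn : -(1 / c) < 0 := by have : 0 < 1 / c := by positivity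
                               linarith
  rw [h]
  refine ⟨(integrableOn_exp_mul_Ioi hn a).const_mul _, ?_⟩
  rw [integral_const_mul, integral_exp_mul_Ioi hn]
  have : Real.exp (-(a - u) / c) = Real.exp (u / c) * Real.exp (-(1 / c) * a) := by
    rw [← Real.exp_add]; congr 1; field_simp; ring
  rw [this]; field_simp

lemma E_Ioi {c : ℝ} (hc : 0 < c) (x u : ℝ) :
    IntegrableOn (fun y => (Ici u).indicator (fun y => expDens c (y - u)) y) (Ioi x) ∧
    ∫ y in Ioi x, (Ici u).indicator (fun y => expDens c (y - u)) y = GG c (x - u) := by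
  constructor
  · exact (expDens_Ioi hc x u).1.indicator measurableSet_Ici
  · rw [setIntegral_indicator measurableSet_Ici]
    have : (Ioi x ∩ Ici u : Set ℝ) =ᵐ[volume] Ioi (max x u) := by
      rw [← Ioi_inter_Ioi]
      exact (ae_eq_refl _).inter Ioi_ae_eq_Ici.symm
    rw [setIntegral_congr_set this, (expDens_Ioi hc _ u).2]
    unfold GG
    rw [show max (x - u) 0 = max x u - u by rw [← max_sub_sub_right, sub_self]]

lemma piTail_eq {c : ℝ} (hc : 0 < c) (θ : ℝ) (Λ : Measure ℝ) [IsProbabilityMeasure Λ]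
    (h0 : Λ (Iic 0) = 0) {x : ℝ} (hx : 0 ≤ x) :
    piTail c θ Λ x = (1 - θ) * GG c x + θ * ∫ u, GG c (x - u) ∂Λ := by
  set h : ℝ → ℝ → ℝ := fun y u => (Ici u).indicator (fun y => expDens c (y - u)) y with hh
  have hpos : ∀ᵐ u ∂Λ, 0 < u := by
    rw [ae_iff]; convert h0 using 2; ext x; simp
  have hnn : ∀ y u, 0 ≤ h y u := fun y u => by
    simp only [hh]
    apply indicator_nonneg
    intro z _
    unfold expDens; positivity
  have hq : ∀ y, ∫ u in Set.Icc (0 : ℝ) y, expDens c (y - u) ∂Λ = ∫ u, h y u ∂Λ := by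
    intro y
    rw [← integral_indicator measurableSet_Icc]
    apply integral_congr_ae
    filter_upwards [hpos] with u hu
    simp [hh, indicator, hu.le]
  have hm : Measurable (Function.uncurry h) := by
    have : Function.uncurry h = {p : ℝ × ℝ | p.2 ≤ p.1}.indicator
        (fun p => expDens c (p.1 - p.2)) := by
      ext ⟨y, u⟩; simp [hh, Function.uncurry, indicator]
    rw [this]
    refine Measurable.indicator ?_ (measurableSet_le measurable_snd measurable_fst)
    unfold expDens; fun_prop
  have hGi : Integrable (fun u => GG c (x - u)) Λ := by
    refine Integrable.of_bound ?_ 1 (Eventually.of_forall fun u => ?_)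
    · exact ((GG_cont c).comp (by fun_prop)).aestronglyMeasurable
    · rw [Real.norm_eq_abs, abs_of_pos (GG_pos _ _)]; exact GG_le hc _
  have hI : Integrable (Function.uncurry h) ((volume.restrict (Ioi x)).prod Λ) := by
    rw [integrable_prod_iff' hm.aestronglyMeasurable]
    refine ⟨Eventually.of_forall fun u => (E_Ioi hc x u).1, ?_⟩
    have : ∀ u, ∫ y in Ioi x, ‖Function.uncurry h (y, u)‖ = GG c (x - u) := fun u => by
      rw [← (E_Ioi hc x u).2]
      congr 1; ext y
      exact abs_of_nonneg (hnn y u)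
    simp_rw [this]; exact hGi
  have hsw := integral_integral_swap hI
  unfold piTail piDens
  have e1 := expDens_Ioi hc x 0
  simp only [sub_zero] at e1
  rw [integral_add (e1.1.const_mul _), integral_const_mul, integral_const_mul, e1.2]
  · simp_rw [hq]
    rw [hsw]
    congr 2
    · unfold GG; rw [max_eq_left hx]
    · congr 1; ext u; exact (E_Ioi hc x u).2
  · simp_rw [hq]
    exact hI.integral_prod_left.const_mul _

lemma GG_ident {c : ℝ} (hc : 0 < c) {t u : ℝ} (ht : 0 ≤ t) (hu : 0 ≤ u) :
    c * GG c (t - u) + ∫ s in (0:ℝ)..t, GG c (s - u) = c + min t u := by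
  have h1 : ∀ r, 0 ≤ r → r ≤ u → ∫ s in (0:ℝ)..r, GG c (s - u) = r := by
    intro r hr hru
    have : ∫ s in (0:ℝ)..r, GG c (s - u) = ∫ s in (0:ℝ)..r, (1:ℝ) := by
      apply intervalIntegral.integral_congr
      intro s hs
      rw [uIcc_of_le hr] at hs
      simp only [GG]
      rw [max_eq_right (by linarith [hs.2])]; simp
    rw [this]; simp
  rcases le_total t u with h | h
  · rw [h1 t ht h, min_eq_left h]
    unfold GG; rw [max_eq_right (by linarith)]; simp
  · rw [min_eq_right h]
    have hc1 : Continuous (fun s => GG c (s - u)) := (GG_cont c).comp (by fun_prop)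
    rw [← intervalIntegral.integral_add_adjacent_intervals (b := u)
      (hc1.intervalIntegrable _ _) (hc1.intervalIntegrable _ _), h1 u hu le_rfl]
    have h2 : ∫ s in u..t, GG c (s - u) = ∫ s in u..t, Real.exp (-(s - u) / c) := by
      apply intervalIntegral.integral_congr
      intro s hs
      rw [uIcc_of_le h] at hs
      simp only [GG]
      rw [max_eq_left (by linarith [hs.1])]
    rw [h2, intervalIntegral.integral_eq_sub_of_hasDerivAt
      (f := fun s => -c * Real.exp (-(s - u) / c))]
    · unfold GG; rw [max_eq_left (by linarith)]; simp; ring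
    · intro s _
      have h3 : HasDerivAt (fun s => -(s - u) / c) (-1 / c) s :=
        (((hasDerivAt_id s).sub_const u).neg).div_const c
      have h4 := h3.exp.const_mul (-c)
      have h5 : -c * (Real.exp (-(s - u) / c) * (-1 / c)) = Real.exp (-(s - u) / c) := by
        field_simp
      rw [h5] at h4; exact h4
    · exact Continuous.intervalIntegrable (by fun_prop) _ _

lemma Lam_int (Λ : Measure ℝ) [IsProbabilityMeasure Λ] (h0 : Λ (Iic 0) = 0) {t : ℝ} (ht : 0 ≤ t) :
    ∫ u, min t u ∂Λ = ∫ s in (0:ℝ)..t, (Λ (Ici s)).toReal := by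
  have hpos : ∀ᵐ u ∂Λ, 0 < u := by
    rw [ae_iff]; convert h0 using 2; ext x; simp
  set D : Set (ℝ × ℝ) := {p | p.1 ≤ p.2} with hD
  have hDm : MeasurableSet D := measurableSet_le measurable_fst measurable_snd
  set g : ℝ × ℝ → ℝ := D.indicator (fun _ => 1) with hg
  have hI : Integrable g ((volume.restrict (Ioc 0 t)).prod Λ) :=
    (integrable_const 1).indicator hDm
  have hsw := integral_integral_swap (f := fun s u => g (s, u)) hI
  rw [intervalIntegral.integral_of_le ht]
  have e1 : ∀ s, ∫ u, g (s, u) ∂Λ = (Λ (Ici s)).toReal := fun s => by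
    have : ∀ u, g (s, u) = (Ici s).indicator (fun _ => (1:ℝ)) u := fun u => by
      simp [hg, hD, indicator]
    simp_rw [this]
    rw [integral_indicator measurableSet_Ici]; simp [Measure.real]
  simp_rw [← e1]
  rw [hsw]
  apply integral_congr_ae
  filter_upwards [hpos] with u hu
  have : ∀ s, g (s, u) = (Iic u).indicator (fun _ => (1:ℝ)) s := fun s => by
    simp [hg, hD, indicator]
  simp_rw [this]
  rw [setIntegral_indicator measurableSet_Iic, Ioc_inter_Iic]
  simp [ht, hu.le]

lemma pi_props {c : ℝ} (hc : 0 < c) (θ : ℝ) (Λ : Measure ℝ) [IsProbabilityMeasure Λ]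
    (h0 : Λ (Iic 0) = 0) : ∃ P : ℝ → ℝ, Continuous P ∧ (∀ t, 0 ≤ t → piTail c θ Λ t = P t) ∧
      ∀ t, 0 ≤ t → c * P t + ∫ s in (0:ℝ)..t, P s =
        c + θ * ∫ s in (0:ℝ)..t, (Λ (Ici s)).toReal := by
  have hpos : ∀ᵐ u ∂Λ, 0 < u := by
    rw [ae_iff]; convert h0 using 2; ext x; simp
  have hGi : ∀ x, Integrable (fun u => GG c (x - u)) Λ := fun x => by
    refine Integrable.of_bound ?_ 1 (Eventually.of_forall fun u => ?_)
    · exact ((GG_cont c).comp (by fun_prop)).aestronglyMeasurable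
    · rw [Real.norm_eq_abs, abs_of_pos (GG_pos _ _)]; exact GG_le hc _
  set Q : ℝ → ℝ := fun x => ∫ u, GG c (x - u) ∂Λ with hQ
  have hQc : Continuous Q := by
    refine continuous_of_dominated (bound := fun _ => 1) (fun x => (hGi x).aestronglyMeasurable)
      (fun x => Eventually.of_forall fun u => ?_) (integrable_const _)
      (Eventually.of_forall fun u => (GG_cont c).comp (by fun_prop))
    rw [Real.norm_eq_abs, abs_of_pos (GG_pos _ _)]; exact GG_le hc _
  have hGc := GG_cont c
  refine ⟨fun x => (1 - θ) * GG c x + θ * Q x, by fun_prop, fun t ht => piTail_eq hc θ Λ h0 ht,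
    fun t ht => ?_⟩
  rw [intervalIntegral.integral_add, intervalIntegral.integral_const_mul,
    intervalIntegral.integral_const_mul]
  · have a1 := GG_ident hc ht le_rfl
    simp only [sub_zero, min_eq_right ht, add_zero] at a1
    have a2 : c * Q t + ∫ s in (0:ℝ)..t, Q s = c + ∫ s in (0:ℝ)..t, (Λ (Ici s)).toReal := by
      rw [← Lam_int Λ h0 ht]
      have hcc : Continuous (Function.uncurry fun s u => GG c (s - u)) :=
        hGc.comp (by fun_prop)
      have hI : Integrable (Function.uncurry fun s u => GG c (s - u))
          ((volume.restrict (Ioc 0 t)).prod Λ) := by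
        refine Integrable.of_bound hcc.aestronglyMeasurable 1 (Eventually.of_forall fun p => ?_)
        simp only [Function.uncurry]
        rw [Real.norm_eq_abs, abs_of_pos (GG_pos _ _)]; exact GG_le hc _
      have hsw := integral_integral_swap hI
      have e1 : ∫ s in (0:ℝ)..t, Q s = ∫ u, (∫ s in (0:ℝ)..t, GG c (s - u)) ∂Λ := by
        simp_rw [intervalIntegral.integral_of_le ht]; exact hsw
      have hi2 : Integrable (fun u => ∫ s in (0:ℝ)..t, GG c (s - u)) Λ := by
        simp_rw [intervalIntegral.integral_of_le ht]; exact hI.integral_prod_right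
      rw [e1, hQ]
      simp only
      rw [← integral_const_mul, ← integral_add ((hGi t).const_mul c) hi2]
      have e2 : ∫ u, (c * GG c (t - u) + ∫ s in (0:ℝ)..t, GG c (s - u)) ∂Λ = 
          ∫ u, (c + min t u) ∂Λ := by
        apply integral_congr_ae
        filter_upwards [hpos] with u hu using GG_ident hc ht hu.le
      rw [e2, integral_add (integrable_const _)]
      · simp
      · refine Integrable.of_bound (by fun_prop) t ?_
        filter_upwards [hpos] with u hu
        rw [Real.norm_eq_abs, abs_of_nonneg (by positivity)]; exact min_le_left _ _
    linear_combination (1 - θ) * a1 + θ * a2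
  · exact Continuous.intervalIntegrable (by fun_prop) _ _
  · exact Continuous.intervalIntegrable (by fun_prop) _ _


lemma R_props (b c : ℝ) (hc : 0 < c) (ν : Measure ℝ) (η θ : ℕ → ℝ) (Λ : ℕ → Measure ℝ) (n : ℕ)
    (hn : 1 ≤ n) (hΛ : IsProbabilityMeasure (Λ n)) (h0 : Λ n (Iic 0) = 0)
    (hM : 0 < tailNu ν (η n)) (hθ : tailNu ν (η n) = (n:ℝ) ^ 2 * θ n / c)
    (hΛtail : ∀ y : ℝ, 0 ≤ y →
      ((Λ n) (Set.Ici y)).toReal = tailNu ν (η n + y / (n : ℝ)) / tailNu ν (η n)) :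
    ∃ R : ℝ → ℝ, Continuous R ∧ (∀ t, 0 ≤ t → RPi b c ν η θ Λ n t = R t) ∧
      ∀ t, 0 ≤ t → c * R (n * t) + ∫ s in (0:ℝ)..t,
        (n * (1 - c * gam b c ν η n) - c * gam b c ν η n *
          ∫ v in (0:ℝ)..(t - s), tailNu ν (η n + v)) * R (n * s) =
        c * gam b c ν η n * (1 + (∫ v in (0:ℝ)..t, tailNu ν (η n + v)) / n) := by
  have hN : (0:ℝ) < n := by exact_mod_cast hn
  obtain ⟨P, hPc, hP1, hP2⟩ := pi_props hc (θ n) (Λ n) h0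
  set γ := gam b c ν η n with hγ
  set F : ℝ → ℝ := fun t => γ * P t with hF
  have hFc : Continuous F := by fun_prop
  obtain ⟨R, hRc, hR1, hR2⟩ := resolvent_exists (fun t => γ * piTail c (θ n) (Λ n) t) F hFc
    (fun t ht => by simp only [hF]; rw [hP1 t ht])
  set H : ℝ → ℝ := fun t => γ * θ n * ∫ s in (0:ℝ)..t, ((Λ n) (Ici s)).toReal with hH
  have hHc : Continuous H := by
    have hanti : Antitone (fun s => ((Λ n) (Ici s)).toReal) := fun x y h =>
      ENNReal.toReal_mono (measure_ne_top _ _) (measure_mono (Ici_subset_Ici.2 h))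
    have := intervalIntegral.continuous_primitive (μ := volume)
      (fun a b => hanti.intervalIntegrable (a := a) (b := b)) 0
    fun_prop
  have hV : ∀ t, 0 ≤ t → c * F t + ∫ s in (0:ℝ)..t, F s = c * γ + H t := by
    intro t ht
    simp only [hF, hH]
    rw [intervalIntegral.integral_const_mul]
    linear_combination γ * hP2 t ht
  refine ⟨R, hRc, hR1, fun t ht => ?_⟩
  have hHs : ∀ x, 0 ≤ x → n * H (n * x) = c * γ * ∫ v in (0:ℝ)..x, tailNu ν (η n + v) := by
    intro x hx
    simp only [hH]
    have e1 : ∫ s in (0:ℝ)..(n * x), ((Λ n) (Ici s)).toReal =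
        ∫ s in (0:ℝ)..(n * x), tailNu ν (η n + s / n) / tailNu ν (η n) := by
      apply intervalIntegral.integral_congr
      intro s hs
      rw [uIcc_of_le (by positivity)] at hs
      exact hΛtail s hs.1
    have e2 : ∫ s in (0:ℝ)..(n * x), tailNu ν (η n + s / n) / tailNu ν (η n) =
        n * ∫ v in (0:ℝ)..x, tailNu ν (η n + v) / tailNu ν (η n) := by
      rw [intervalIntegral.integral_comp_div (fun v => tailNu ν (η n + v) / tailNu ν (η n)) hN.ne']
      simp [hN.ne']
    rw [e1, e2, intervalIntegral.integral_div]
    set A := ∫ v in (0:ℝ)..x, tailNu ν (η n + v)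
    have : θ n = c * tailNu ν (η n) / n ^ 2 := by rw [hθ]; field_simp
    rw [this]; field_simp
  have h1 := resolvent_volterra F R H c (c * γ) hFc hRc hHc hR2 hV (t := n * t) (by positivity)
  have h2 : ∫ s in (0:ℝ)..(n * t), (1 - c * γ - H (n * t - s)) * R s =
      ∫ s in (0:ℝ)..t, (n * (1 - c * γ) - c * γ *
          ∫ v in (0:ℝ)..(t - s), tailNu ν (η n + v)) * R (n * s) := by
    have e1 := intervalIntegral.smul_integral_comp_mul_left (a := 0) (b := t)
      (fun s => (1 - c * γ - H (n * t - s)) * R s) (n:ℝ)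
    rw [mul_zero] at e1
    rw [← e1, smul_eq_mul, ← intervalIntegral.integral_const_mul]
    apply intervalIntegral.integral_congr
    intro s hs
    rw [uIcc_of_le ht] at hs
    simp only
    rw [← hHs (t - s) (by linarith [hs.2]), mul_sub (n:ℝ) t s]; ring
  rw [h2] at h1
  rw [h1]
  have h3 := hHs t ht
  have : H (n * t) = c * γ * (∫ v in (0:ℝ)..t, tailNu ν (η n + v)) / n := by
    rw [← h3]; field_simp
  rw [this]; ring


lemma JJ_split {ν : Measure ℝ} {e a : ℝ} (ha : 0 ≤ a) :
    JJ ν e ≤ ENNReal.ofReal a * ν (Ici e) + JJ ν (e + a) := by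
  unfold JJ
  have h1 : Ioi e = Ioc e (e + a) ∪ Ioi (e + a) := (Ioc_union_Ioi_eq_Ioi (by linarith)).symm
  rw [h1]
  refine (lintegral_union_le _ _ _).trans (add_le_add ?_ le_rfl)
  calc ∫⁻ y in Ioc e (e + a), ν (Ici y) ≤ ∫⁻ y in Ioc e (e + a), ν (Ici e) :=
        setLIntegral_mono' measurableSet_Ioc fun y hy => measure_mono (Ici_subset_Ici.2 hy.1.le)
    _ = _ := by simp [mul_comm]

lemma seq_props (c : ℝ) (hc : 0 < c)
    (ν : Measure ℝ) (hν0 : ν (Set.Iic 0) = 0)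
    (hνint : ∫⁻ y in Set.Ioi (0 : ℝ), ENNReal.ofReal (min y (y ^ 2)) ∂ν ≠ ⊤)
    (η θ : ℕ → ℝ) (hη : ∀ n : ℕ, 0 ≤ η n)
    (hseq : (ν (Set.Ici (0 : ℝ)) ≠ ⊤ ∧ (∀ n : ℕ, 1 ≤ n → η n = 0) ∧
        (∀ n : ℕ, 1 ≤ n → θ n = c * tailNu ν 0 / (n : ℝ) ^ 2)) ∨
      (ν (Set.Ici (0 : ℝ)) = ⊤ ∧
        Filter.Tendsto (fun n : ℕ => (n : ℝ) * θ n) Filter.atTop (nhds 0) ∧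
        Filter.Tendsto (fun n : ℕ => (n : ℝ) ^ 2 * θ n) Filter.atTop Filter.atTop ∧
        (∀ n : ℕ, 1 ≤ n → tailNu ν (η n) = (n : ℝ) ^ 2 * θ n / c)))
    (Λ : ℕ → Measure ℝ)
    (hΛprob : ∀ n : ℕ, 1 ≤ n → IsProbabilityMeasure (Λ n))
    (hΛtail : ∀ n : ℕ, 1 ≤ n → ∀ y : ℝ, 0 ≤ y →
      ((Λ n) (Set.Ici y)).toReal = tailNu ν (η n + y / (n : ℝ)) / tailNu ν (η n))
    (hΛsupp : ∀ n : ℕ, 1 ≤ n → Λ n (Set.Iic 0) = 0) :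
    (∀ n : ℕ, 1 ≤ n → 0 < tailNu ν (η n) ∧ tailNu ν (η n) = (n : ℝ) ^ 2 * θ n / c ∧
      ν (Ici (η n)) < ⊤ ∧ JJ ν (η n) < ⊤) ∧
    Tendsto η atTop (𝓝 0) ∧ Tendsto (fun n : ℕ => tailNu ν (η n) / n) atTop (𝓝 0) := by
  have hM : ∀ n : ℕ, 1 ≤ n → 0 < tailNu ν (η n) := by
    intro n hn
    refine lt_of_le_of_ne (tailNu_nonneg _) fun h => ?_
    have h1 := hΛtail n hn 0 le_rfl
    rw [← h, div_zero] at h1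
    have := hΛprob n hn
    have h2 : Λ n univ ≤ Λ n (Iic 0) + Λ n (Ici 0) := by
      rw [← Iic_union_Ici (a := (0:ℝ))]; exact measure_union_le _ _
    rw [hΛsupp n hn, zero_add, measure_univ] at h2
    rcases (ENNReal.toReal_eq_zero_iff _).1 h1 with h3 | h3
    · rw [h3] at h2; simp at h2
    · exact measure_ne_top _ _ h3
  have hMt : ∀ n : ℕ, 1 ≤ n → ν (Ici (η n)) < ⊤ := by
    intro n hn
    have := hM n hn
    unfold tailNu at this
    exact (ENNReal.toReal_pos_iff.1 this).2
  have hJ : ∀ n : ℕ, 1 ≤ n → JJ ν (η n) < ⊤ := by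
    intro n hn
    refine (JJ_split (a := 1) zero_le_one).trans_lt ?_
    refine ENNReal.add_lt_top.2 ⟨ENNReal.mul_lt_top (by simp) (hMt n hn), ?_⟩
    exact JJ_lt_top hν0 hνint (by linarith [hη n])
  rcases hseq with ⟨h1, h2, h3⟩ | ⟨h1, h2, h3, h4⟩
  · refine ⟨fun n hn => ⟨hM n hn, ?_, hMt n hn, hJ n hn⟩, ?_, ?_⟩
    · rw [h3 n hn, h2 n hn]
      have : (0:ℝ) < n := by exact_mod_cast hn
      field_simp
    · refine tendsto_const_nhds.congr' ?_
      filter_upwards [eventually_ge_atTop 1] with n hn using (h2 n hn).symm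
    · refine (tendsto_const_div_atTop_nhds_zero_nat (tailNu ν 0)).congr' ?_
      filter_upwards [eventually_ge_atTop 1] with n hn
      rw [h2 n hn]
  · refine ⟨fun n hn => ⟨hM n hn, h4 n hn, hMt n hn, hJ n hn⟩, ?_, ?_⟩
    · rw [Metric.tendsto_atTop]
      intro ε hε
      have h5 := (h3.eventually_gt_atTop (c * tailNu ν ε)).and (eventually_ge_atTop 1)
      obtain ⟨N, hN⟩ := eventually_atTop.1 h5
      refine ⟨N, fun n hn => ?_⟩
      obtain ⟨h6, h7⟩ := hN n hn
      rw [Real.dist_eq, sub_zero, abs_of_nonneg (hη n)]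
      by_contra! h8
      have h9 := tailNu_anti (nu_Ici_lt_top hνint hε) h8
      rw [h4 n h7, div_le_iff₀ hc] at h9
      linarith
    · have := h2.div_const c
      rw [zero_div] at this
      refine this.congr' ?_
      filter_upwards [eventually_ge_atTop 1] with n hn
      rw [h4 n hn]
      have : (0:ℝ) < n := by exact_mod_cast hn
      field_simp

section kern
variable {ν : Measure ℝ} (hν0 : ν (Set.Iic 0) = 0)
    (hνint : ∫⁻ y in Set.Ioi (0 : ℝ), ENNReal.ofReal (min y (y ^ 2)) ∂ν ≠ ⊤)

lemma itail_nonneg (x : ℝ) : 0 ≤ itailNu ν x := integral_nonneg fun y => tailNu_nonneg y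

include hνint in
lemma itail_eq' {s : ℝ} (hs : 0 ≤ s) : itailNu ν s = (JJ ν s).toReal :=
  itailNu_eq fun y hy => nu_Ici_lt_top hνint (hs.trans_lt hy)

include hν0 hνint in
lemma itail_anti {s t : ℝ} (hs : 0 ≤ s) (hJ : JJ ν s < ⊤) (hst : s ≤ t) : itailNu ν t ≤ itailNu ν s := by
  rw [itail_eq' hνint hs, itail_eq' hνint (hs.trans hst)]
  exact ENNReal.toReal_mono hJ.ne (JJ_anti hst)

include hν0 hνint in
lemma itail_lap {l : ℝ} (hl : 0 < l) :
    IntegrableOn (fun t => Real.exp (-l * t) * itailNu ν t) (Ioi 0) := by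
  have h := lapJ 0 0 hν0 hνint hl
  have h1 : IntegrableOn (fun t => (ENNReal.ofReal (Real.exp (-l * t)) * JJ ν t).toReal) (Ioi 0) := by
    refine integrable_toReal_of_lintegral_ne_top ?_ (by rw [h]; simp)
    have := (JJ_anti (ν := ν)).measurable
    fun_prop
  refine h1.congr_fun (fun t ht => ?_) measurableSet_Ioi
  have ht : 0 < t := ht
  simp only [ENNReal.toReal_mul, itail_eq' hνint ht.le]
  rw [ENNReal.toReal_ofReal (Real.exp_pos _).le]

include hν0 hνint in
lemma itail_small : Tendsto (fun a : ℝ => a * itailNu ν a) (𝓝[>] 0) (𝓝 0) := by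
  have h1 : IntegrableOn (itailNu ν) (Ioc 0 1) := by
    have := (itail_lap hν0 hνint one_pos).mono_set (Ioc_subset_Ioi_self : Ioc (0:ℝ) 1 ⊆ Ioi 0)
    have h2 : IntegrableOn (fun t => Real.exp t * (Real.exp (-1 * t) * itailNu ν t)) (Ioc 0 1) := by
      refine Integrable.bdd_mul (c := Real.exp 1) this (by fun_prop) ?_
      filter_upwards [ae_restrict_mem measurableSet_Ioc] with t ht
      rw [Real.norm_eq_abs, abs_of_pos (Real.exp_pos _)]
      exact Real.exp_le_exp.2 ht.2
    refine h2.congr_fun (fun t ht => ?_) measurableSet_Ioc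
    simp only
    rw [← mul_assoc, ← Real.exp_add]; simp
  have hii : IntervalIntegrable (itailNu ν) volume 0 1 := by
    rwa [intervalIntegrable_iff_integrableOn_Ioc_of_le zero_le_one]
  have hcont := intervalIntegral.continuousWithinAt_primitive (a := 0) (b₁ := 0) (b₂ := 1) (b₀ := 0)
    (f := itailNu ν) (μ := volume) (by simp) (by simpa using hii)
  have h3 : Tendsto (fun a : ℝ => ∫ t in (0:ℝ)..a, itailNu ν t) (𝓝[>] 0) (𝓝 0) := by
    have h4 := hcont.tendsto
    rw [intervalIntegral.integral_same] at h4
    refine h4.mono_left ?_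
    rw [← nhdsWithin_Ioc_eq_nhdsGT (zero_lt_one' ℝ)]
    exact nhdsWithin_mono _ Ioc_subset_Icc_self
  refine tendsto_of_tendsto_of_tendsto_of_le_of_le' tendsto_const_nhds h3 ?_ ?_
  · filter_upwards [self_mem_nhdsWithin] with a ha
    exact mul_nonneg (le_of_lt ha) (itail_nonneg a)
  · filter_upwards [Ioc_mem_nhdsGT (zero_lt_one' ℝ)] with a ha
    have : ∫ t in (0:ℝ)..a, itailNu ν a ≤ ∫ t in (0:ℝ)..a, itailNu ν t := by
      refine intervalIntegral.integral_mono_on_of_le_Ioo ha.1.le (by simp) ?_ ?_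
      · exact hii.mono_set (by rw [uIcc_of_le ha.1.le, uIcc_of_le zero_le_one]; exact Icc_subset_Icc le_rfl ha.2)
      · intro t ht
        exact itail_anti hν0 hνint ht.1.le (JJ_lt_top hν0 hνint ht.1) ht.2.le
    simpa using this

include hν0 hνint in
lemma mn_small (η : ℕ → ℝ) (hη : ∀ n : ℕ, 0 ≤ η n)
    (h1 : ∀ n : ℕ, 1 ≤ n → ν (Ici (η n)) < ⊤ ∧ JJ ν (η n) < ⊤)
    (h2 : Tendsto (fun n : ℕ => tailNu ν (η n) / n) atTop (𝓝 0)) :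
    Tendsto (fun n : ℕ => itailNu ν (η n) / √(n:ℝ)) atTop (𝓝 0) := by
  have hs : Tendsto (fun n : ℕ => 1 / √(n:ℝ)) atTop (𝓝[>] 0) := by
    refine tendsto_nhdsWithin_iff.2 ⟨?_, ?_⟩
    · simp only [one_div]
      exact tendsto_inv_atTop_zero.comp (Real.tendsto_sqrt_atTop.comp tendsto_natCast_atTop_atTop)
    · filter_upwards [eventually_ge_atTop 1] with n hn
      have : (0:ℝ) < n := by exact_mod_cast hn
      simp only [mem_Ioi]; positivity
  have h3 := h2.add ((itail_small hν0 hνint).comp hs)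
  rw [add_zero] at h3
  refine tendsto_of_tendsto_of_tendsto_of_le_of_le' tendsto_const_nhds h3 ?_ ?_
  · filter_upwards with n
    exact div_nonneg (itail_nonneg _) (Real.sqrt_nonneg _)
  · filter_upwards [eventually_ge_atTop 1] with n hn
    have hN : (0:ℝ) < n := by exact_mod_cast hn
    have hsq : 0 < √(n:ℝ) := Real.sqrt_pos.2 hN
    have ha : 0 < 1 / √(n:ℝ) := by positivity
    obtain ⟨h4, h5⟩ := h1 n hn
    have h6 := JJ_split (ν := ν) (e := η n) ha.le
    have h7 := JJ_lt_top hν0 hνint ha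
    have h8 : JJ ν (η n + 1 / √(n:ℝ)) ≤ JJ ν (1 / √(n:ℝ)) := JJ_anti (by linarith [hη n])
    have h9 : itailNu ν (η n) ≤ 1 / √(n:ℝ) * tailNu ν (η n) + itailNu ν (1 / √(n:ℝ)) := by
      rw [itail_eq' hνint (hη n), itail_eq' hνint ha.le]
      have := ENNReal.toReal_mono (ENNReal.add_lt_top.2
        ⟨ENNReal.mul_lt_top (by simp) h4, h7⟩).ne (h6.trans (add_le_add le_rfl h8))
      rw [ENNReal.toReal_add (ENNReal.mul_lt_top (by simp) h4).ne h7.ne, ENNReal.toReal_mul,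
        ENNReal.toReal_ofReal ha.le] at this
      exact this
    simp only [Function.comp]
    rw [div_le_iff₀ hsq]
    refine h9.trans (le_of_eq ?_)
    have : √(n:ℝ) ^ 2 = n := Real.sq_sqrt hN.le
    rw [add_mul]
    congr 1
    · rw [one_div_mul_eq_div, div_mul_eq_mul_div, div_eq_div_iff hsq.ne' hN.ne']
      nth_rw 1 [← this]; ring
    · field_simp
end kern


lemma loc_int {q : ℝ → ℝ} {β : ℝ}
    (hq : IntegrableOn (fun u => Real.exp (-β * u) * q u) (Ioi 0)) (t : ℝ) (ht : 0 ≤ t) :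
    IntervalIntegrable q volume 0 t := by
  have h1 : IntervalIntegrable (fun u => Real.exp (-β * u) * q u) volume 0 t := by
    rw [intervalIntegrable_iff_integrableOn_Ioc_of_le ht]
    exact hq.mono_set Ioc_subset_Ioi_self
  have h2 := h1.mul_continuousOn (g := fun u => Real.exp (β * u)) (by fun_prop)
  refine h2.congr ?_
  intro u _
  simp only
  rw [mul_right_comm, ← Real.exp_add]; simp

lemma loc_int' {q g : ℝ → ℝ} {β : ℝ}
    (hq : IntegrableOn (fun u => Real.exp (-β * u) * q u) (Ioi 0)) (hg : Continuous g) (t : ℝ) (ht : 0 ≤ t) :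
    IntervalIntegrable (fun s => q (t - s) * g s) volume 0 t := by
  have h1 := ((loc_int hq t ht).comp_sub_left t).symm
  simp only [sub_zero, sub_self] at h1
  exact h1.mul_continuousOn hg.continuousOn

lemma conv_est {q g : ℝ → ℝ} {β G t : ℝ} (ht : 0 ≤ t)
    (hq : IntegrableOn (fun u => Real.exp (-β * u) * q u) (Ioi 0))
    (hG0 : 0 ≤ G)
    (hG : ∀ s ∈ Icc 0 t, Real.exp (-β * s) * |g s| ≤ G) :
    Real.exp (-β * t) * |∫ s in (0:ℝ)..t, q (t - s) * g s| ≤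
      G * ∫ u in Ioi (0:ℝ), Real.exp (-β * u) * |q u| := by
  have hqa : IntegrableOn (fun u => Real.exp (-β * u) * |q u|) (Ioi 0) := by
    refine IntegrableOn.congr_fun (Integrable.abs hq) (fun u _ => ?_) measurableSet_Ioi
    simp only [abs_mul, abs_of_pos (Real.exp_pos _)]
  have hqi : IntervalIntegrable (fun u => Real.exp (-β * u) * |q u|) volume 0 t := by
    rw [intervalIntegrable_iff_integrableOn_Ioc_of_le ht]
    exact hqa.mono_set Ioc_subset_Ioi_self
  have hqs : IntervalIntegrable (fun s => Real.exp (-β * (t - s)) * |q (t - s)|) volume 0 t := by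
    have := (hqi.comp_sub_left t).symm
    simpa using this
  have e1 : Real.exp (-β * t) * |∫ s in (0:ℝ)..t, q (t - s) * g s| =
      |∫ s in (0:ℝ)..t, Real.exp (-β * t) * (q (t - s) * g s)| := by
    rw [intervalIntegral.integral_const_mul, abs_mul, abs_of_pos (Real.exp_pos _)]
  rw [e1, ← Real.norm_eq_abs]
  calc ‖∫ s in (0:ℝ)..t, Real.exp (-β * t) * (q (t - s) * g s)‖
      ≤ ∫ s in (0:ℝ)..t, G * (Real.exp (-β * (t - s)) * |q (t - s)|) := by
        refine intervalIntegral.norm_integral_le_of_norm_le ht ?_ (hqs.const_mul G)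
        filter_upwards with s hs
        rw [Real.norm_eq_abs, abs_mul, abs_mul, abs_of_pos (Real.exp_pos _)]
        have := hG s ⟨hs.1.le, hs.2⟩
        have e2 : Real.exp (-β * t) = Real.exp (-β * (t - s)) * Real.exp (-β * s) := by
          rw [← Real.exp_add]; congr 1; ring
        rw [e2]
        calc _ = (Real.exp (-β * s) * |g s|) * (Real.exp (-β * (t - s)) * |q (t - s)|) := by ring
          _ ≤ _ := by gcongr
    _ = G * ∫ u in (0:ℝ)..t, Real.exp (-β * u) * |q u| := by
        rw [intervalIntegral.integral_const_mul,
          intervalIntegral.integral_comp_sub_left (fun u => Real.exp (-β * u) * |q u|) t]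
        simp
    _ ≤ _ := by
        refine mul_le_mul_of_nonneg_left ?_ hG0
        rw [intervalIntegral.integral_of_le ht]
        refine setIntegral_mono_set hqa ?_ (Ioc_subset_Ioi_self.eventuallyLE)
        filter_upwards with u
        positivity

lemma stab {c ε δ β : ℝ} (hc : 0 < c) (hβ : 0 ≤ β) (V r k k' a : ℝ → ℝ) (hV : Continuous V)
    (hr : Continuous r) (hVb : ∀ t, |V t| ≤ 1 / c) (hk'0 : ∀ t, 0 < t → 0 ≤ k' t)
    (hk : IntegrableOn (fun u => Real.exp (-β * u) * k u) (Ioi 0))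
    (hk' : IntegrableOn (fun u => Real.exp (-β * u) * k' u) (Ioi 0))
    (hVeq : ∀ᵐ t ∂(volume.restrict (Ioi (0:ℝ))), c * V t + ∫ s in (0:ℝ)..t, k (t - s) * V s = 1)
    (hreq : ∀ t, 0 ≤ t → c * r t + ∫ s in (0:ℝ)..t, k' (t - s) * r s = a t)
    (ha : ∀ t, 0 ≤ t → |a t - 1| ≤ ε)
    (h1 : ∫ u in Ioi (0:ℝ), Real.exp (-β * u) * k' u ≤ c / 2)
    (h2 : ∫ u in Ioi (0:ℝ), Real.exp (-β * u) * |k' u - k u| ≤ δ) :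
    ∀ t, 0 ≤ t → Real.exp (-β * t) * |r t - V t| ≤ 2 / c * (ε + δ / c) := by
  set D : ℝ → ℝ := fun t => Real.exp (-β * t) * |r t - V t| with hD
  have hDc : Continuous D := by fun_prop
  have h1' : ∫ u in Ioi (0:ℝ), Real.exp (-β * u) * |k' u| ≤ c / 2 := by
    refine le_trans (le_of_eq ?_) h1
    refine setIntegral_congr_fun measurableSet_Ioi fun u hu => ?_
    simp only [abs_of_nonneg (hk'0 u hu)]
  have hkk : IntegrableOn (fun u => Real.exp (-β * u) * (k' u - k u)) (Ioi 0) := by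
    refine (hk'.sub hk).congr_fun (fun u _ => ?_) measurableSet_Ioi
    simp only [Pi.sub_apply]; ring
  have key : ∀ T, 0 < T → ∀ t ∈ Icc 0 T, D t ≤ 2 / c * (ε + δ / c) := by
    intro T hT
    obtain ⟨t0, ht0, hmax⟩ := isCompact_Icc.exists_isMaxOn (nonempty_Icc.2 hT.le) hDc.continuousOn
    set S := D t0
    have hS0 : 0 ≤ S := by positivity
    set C := ε + δ / c + S * (c / 2) with hC
    have hae : ∀ᵐ t ∂(volume.restrict (Ioi (0:ℝ))), t ∈ Icc 0 T → c * D t ≤ C := by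
      filter_upwards [hVeq, ae_restrict_mem measurableSet_Ioi] with t hVt ht htT
      have ht : 0 ≤ t := le_of_lt ht
      have hrt := hreq t ht
      have e1 : ∫ s in (0:ℝ)..t, k' (t - s) * (r s - V s) =
          (∫ s in (0:ℝ)..t, k' (t - s) * r s) - ∫ s in (0:ℝ)..t, k' (t - s) * V s := by
        rw [← intervalIntegral.integral_sub (loc_int' hk' hr t ht) (loc_int' hk' hV t ht)]
        congr 1; ext s; ring
      have e2 : ∫ s in (0:ℝ)..t, (k' (t - s) - k (t - s)) * V s =
          (∫ s in (0:ℝ)..t, k' (t - s) * V s) - ∫ s in (0:ℝ)..t, k (t - s) * V s := by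
        rw [← intervalIntegral.integral_sub (loc_int' hk' hV t ht) (loc_int' hk hV t ht)]
        congr 1; ext s; ring
      have e3 : c * (r t - V t) = (a t - 1) - (∫ s in (0:ℝ)..t, k' (t - s) * (r s - V s)) -
          ∫ s in (0:ℝ)..t, (k' (t - s) - k (t - s)) * V s := by
        rw [e1, e2]; linarith
      have b1 := conv_est (g := fun s => r s - V s) ht hk' hS0 (fun s hs =>
        hmax (show s ∈ Icc 0 T from ⟨hs.1, hs.2.trans htT.2⟩))
      have b2 := conv_est (g := V) (G := 1 / c) ht hkk (by positivity) (fun s hs => by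
        have : Real.exp (-β * s) ≤ 1 := Real.exp_le_one_iff.2 (by nlinarith [hs.1])
        calc _ ≤ 1 * (1 / c) := mul_le_mul this (hVb s) (abs_nonneg _) zero_le_one
          _ = _ := by ring)
      have b1' : _ ≤ S * (c / 2) := b1.trans (mul_le_mul_of_nonneg_left h1' hS0)
      have b2' : _ ≤ 1 / c * δ := b2.trans (mul_le_mul_of_nonneg_left h2 (by positivity))
      have b0 : Real.exp (-β * t) * |a t - 1| ≤ ε := by
        have : Real.exp (-β * t) ≤ 1 := Real.exp_le_one_iff.2 (by nlinarith)
        calc _ ≤ 1 * |a t - 1| := by gcongr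
          _ ≤ ε := by rw [one_mul]; exact ha t ht
      calc c * D t = Real.exp (-β * t) * |c * (r t - V t)| := by
            rw [abs_mul, abs_of_pos hc]; simp only [hD]; ring
        _ ≤ Real.exp (-β * t) * (|a t - 1| + |∫ s in (0:ℝ)..t, k' (t - s) * (r s - V s)| +
            |∫ s in (0:ℝ)..t, (k' (t - s) - k (t - s)) * V s|) := by
            rw [e3]
            gcongr
            exact (abs_sub _ _).trans (add_le_add (abs_sub _ _) le_rfl)
        _ ≤ C := by rw [hC, mul_add, mul_add, div_eq_mul_one_div δ c]; linarith
    have hae2 : (fun t => max (c * D t) C) =ᵐ[volume.restrict (Icc 0 T)] fun _ => C := by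
      rw [← Measure.restrict_congr_set (Ioc_ae_eq_Icc (α := ℝ) (μ := volume) (a := 0) (b := T))]
      have := ae_restrict_of_ae_restrict_of_subset (Ioc_subset_Ioi_self : Ioc (0:ℝ) T ⊆ Ioi 0) hae
      filter_upwards [this, ae_restrict_mem measurableSet_Ioc] with t h ht
      exact max_eq_right (h ⟨ht.1.le, ht.2⟩)
    have h3 := Measure.eqOn_Icc_of_ae_eq volume hT.ne hae2 (by fun_prop) (by fun_prop) ht0
    have h4 : c * S ≤ C := by
      exact (le_max_left _ _).trans h3.le
    intro t ht
    refine (hmax ht).trans ?_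
    change S ≤ _
    have h5 : c * S ≤ 2 * (ε + δ / c) := by rw [hC] at h4; linarith
    rw [div_mul_eq_mul_div, le_div_iff₀ hc]; linarith
  intro t ht
  exact key (t + 1) (by linarith) t ⟨ht, by linarith⟩


section kern2
variable {ν : Measure ℝ}

noncomputable def Kf (ν : Measure ℝ) (t : ℝ) : ℝ := (JJ ν t).toReal

lemma Kf_meas : Measurable (Kf ν) := (JJ_anti (ν := ν)).measurable.ennreal_toReal
lemma Kf_nonneg (t : ℝ) : 0 ≤ Kf ν t := ENNReal.toReal_nonneg

lemma Kf_anti {s t : ℝ} (hJ : JJ ν s < ⊤) (hst : s ≤ t) : Kf ν t ≤ Kf ν s :=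
  ENNReal.toReal_mono hJ.ne (JJ_anti hst)

lemma Kf_lap (hν0 : ν (Set.Iic 0) = 0)
    (hνint : ∫⁻ y in Set.Ioi (0 : ℝ), ENNReal.ofReal (min y (y ^ 2)) ∂ν ≠ ⊤) {l : ℝ} (hl : 0 < l) :
    IntegrableOn (fun t => Real.exp (-l * t) * Kf ν t) (Ioi 0) := by
  refine (itail_lap hν0 hνint hl).congr_fun (fun t ht => ?_) measurableSet_Ioi
  simp only [itail_eq' hνint (le_of_lt ht), Kf]

lemma exp_int {l : ℝ} (hl : 0 < l) (d : ℝ) :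
    IntegrableOn (fun t => Real.exp (-l * t) * d) (Ioi 0) :=
  Integrable.mul_const (exp_neg_integrableOn_Ioi 0 hl) d

lemma exp_k_int (hν0 : ν (Set.Iic 0) = 0)
    (hνint : ∫⁻ y in Set.Ioi (0 : ℝ), ENNReal.ofReal (min y (y ^ 2)) ∂ν ≠ ⊤) {l : ℝ} (hl : 0 < l)
    (d : ℝ) :
    IntegrableOn (fun t => Real.exp (-l * t) * (d + Kf ν t)) (Ioi 0) := by
  refine IntegrableOn.congr_fun (Integrable.add (exp_int hl d) (Kf_lap hν0 hνint hl)) (fun t _ => ?_) measurableSet_Ioi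
  simp only [Pi.add_apply]; ring

lemma exists_beta (hν0 : ν (Set.Iic 0) = 0)
    (hνint : ∫⁻ y in Set.Ioi (0 : ℝ), ENNReal.ofReal (min y (y ^ 2)) ∂ν ≠ ⊤) (d : ℝ) {r : ℝ}
    (hr : 0 < r) :
    ∃ β : ℝ, 0 < β ∧ ∫ t in Ioi (0:ℝ), Real.exp (-β * t) * (d + Kf ν t) ≤ r := by
  have h : Tendsto (fun β : ℝ => ∫ t in Ioi (0:ℝ), Real.exp (-β * t) * (d + Kf ν t)) atTop
      (𝓝 (∫ t in Ioi (0:ℝ), (0:ℝ))) := by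
    refine tendsto_integral_filter_of_dominated_convergence
      (fun t => |Real.exp (-1 * t) * (d + Kf ν t)|) ?_ ?_ ?_ ?_
    · filter_upwards with β
      have := Kf_meas (ν := ν)
      exact Measurable.aestronglyMeasurable (by fun_prop)
    · filter_upwards [eventually_ge_atTop 1] with β hβ
      filter_upwards [ae_restrict_mem measurableSet_Ioi] with t ht
      have ht : 0 < t := ht
      rw [Real.norm_eq_abs, abs_mul, abs_mul, abs_of_pos (Real.exp_pos _), abs_of_pos (Real.exp_pos _)]
      gcongr
    · exact Integrable.abs (exp_k_int hν0 hνint one_pos d)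
    · filter_upwards [ae_restrict_mem measurableSet_Ioi] with t ht
      have ht : 0 < t := ht
      have : Tendsto (fun β : ℝ => Real.exp (-β * t)) atTop (𝓝 0) := by
        refine Real.tendsto_exp_atBot.comp ?_
        exact (tendsto_neg_atTop_atBot).atBot_mul_const ht
      simpa using this.mul_const (d + Kf ν t)
  rw [integral_zero] at h
  obtain ⟨β, h1, h2⟩ := ((h.eventually (gt_mem_nhds hr)).and (eventually_gt_atTop 0)).exists
  exact ⟨β, h2, h1.le⟩

lemma A_eq (hνint : ∫⁻ y in Set.Ioi (0 : ℝ), ENNReal.ofReal (min y (y ^ 2)) ∂ν ≠ ⊤)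
    {e u : ℝ} (he : 0 ≤ e) (hu : 0 ≤ u) (hJ : JJ ν e < ⊤) :
    ∫ v in (0:ℝ)..u, tailNu ν (e + v) = Kf ν e - Kf ν (e + u) := by
  rw [intervalIntegral.integral_comp_add_left (fun v => tailNu ν v) e, add_zero]
  have h1 := itail_eq' hνint he
  have h2 := itail_eq' hνint (add_nonneg he hu)
  unfold Kf
  rw [← h1, ← h2]
  unfold itailNu
  rw [intervalIntegral.integral_Ioi_sub_Ioi (tailNu_integrableOn_of hJ) (by linarith)]

lemma m_eq (hνint : ∫⁻ y in Set.Ioi (0 : ℝ), ENNReal.ofReal (min y (y ^ 2)) ∂ν ≠ ⊤)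
    {e : ℝ} (he : 0 ≤ e) : ∫ y in Ioi (0:ℝ), tailNu ν (e + y) = Kf ν e := by
  unfold Kf
  rw [← itail_eq' hνint he]
  unfold itailNu
  have := (measurePreserving_add_left volume e).setIntegral_preimage_emb
    (measurableEmbedding_addLeft e) (tailNu ν) (Ioi e)
  simpa using this

lemma Kf_tendsto (hν0 : ν (Set.Iic 0) = 0)
    (hνint : ∫⁻ y in Set.Ioi (0 : ℝ), ENNReal.ofReal (min y (y ^ 2)) ∂ν ≠ ⊤) {t : ℝ} (ht : 0 < t)
    (η : ℕ → ℝ) (hη : ∀ n : ℕ, 0 ≤ η n) (h : Tendsto η atTop (𝓝 0)) :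
    Tendsto (fun n => Kf ν (η n + t)) atTop (𝓝 (Kf ν t)) := by
  have h1 : Tendsto (fun n => Kf ν t - η n * tailNu ν t) atTop (𝓝 (Kf ν t)) := by
    simpa using (h.mul_const (tailNu ν t)).const_sub (Kf ν t)
  refine tendsto_of_tendsto_of_tendsto_of_le_of_le h1 tendsto_const_nhds (fun n => ?_) (fun n => ?_)
  · have h2 := A_eq hνint ht.le (hη n) (JJ_lt_top hν0 hνint ht)
    have h3 : ‖∫ v in (0:ℝ)..(η n), tailNu ν (t + v)‖ ≤ tailNu ν t * |η n - 0| := by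
      refine intervalIntegral.norm_integral_le_of_norm_le_const fun v hv => ?_
      rw [uIoc_of_le (hη n)] at hv
      rw [Real.norm_eq_abs, abs_of_nonneg (tailNu_nonneg _)]
      exact tailNu_anti (nu_Ici_lt_top hνint ht) (by linarith [hv.1])
    rw [sub_zero, abs_of_nonneg (hη n), h2, Real.norm_eq_abs] at h3
    have := (le_abs_self _).trans h3
    simp only
    rw [add_comm (η n) t]; linarith
  · exact Kf_anti (JJ_lt_top hν0 hνint ht) (by linarith [hη n])
end kern2

lemma main_est (b c : ℝ) (hb : 0 ≤ b) (hc : 0 < c)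
    (ν : Measure ℝ) (hν0 : ν (Set.Iic 0) = 0)
    (hνint : ∫⁻ y in Set.Ioi (0 : ℝ), ENNReal.ofReal (min y (y ^ 2)) ∂ν ≠ ⊤)
    (η : ℕ → ℝ) (hη : ∀ n : ℕ, 0 ≤ η n)
    (h1 : ∀ n : ℕ, 1 ≤ n → ν (Ici (η n)) < ⊤ ∧ JJ ν (η n) < ⊤)
    (hη0 : Tendsto η atTop (𝓝 0)) (h2 : Tendsto (fun n : ℕ => tailNu ν (η n) / n) atTop (𝓝 0))
    (V : ℝ → ℝ) (hV : Continuous V) (hV0 : ∀ t, 0 ≤ V t) (hVb : ∀ t, V t ≤ 1 / c)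
    (hVeq : ∀ᵐ t ∂(volume.restrict (Ioi (0:ℝ))),
        c * V t + ∫ s in (0:ℝ)..t, (b + itailNu ν (t - s)) * V s = 1)
    (R : ℕ → ℝ → ℝ) (hR : ∀ n, 1 ≤ n → Continuous (R n))
    (hReq : ∀ n : ℕ, 1 ≤ n → ∀ t, 0 ≤ t → c * R n (n * t) + ∫ s in (0:ℝ)..t,
        (n * (1 - c * gam b c ν η n) - c * gam b c ν η n *
          ∫ v in (0:ℝ)..(t - s), tailNu ν (η n + v)) * R n (n * s) =
        c * gam b c ν η n * (1 + (∫ v in (0:ℝ)..t, tailNu ν (η n + v)) / n)) :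
    ∃ β : ℝ, 0 < β ∧ ∃ e : ℕ → ℝ, Tendsto e atTop (𝓝 0) ∧ 
      ∀ᶠ n : ℕ in atTop, ∀ t, 0 ≤ t → Real.exp (-β * t) * |R n (n * t) - V t| ≤ e n := by
  obtain ⟨β, hβ, hβc⟩ := exists_beta hν0 hνint (b + 1) (half_pos hc)
  set m : ℕ → ℝ := fun n => Kf ν (η n) with hm
  have hm0 : ∀ n, 0 ≤ m n := fun n => Kf_nonneg _
  have hms : Tendsto (fun n : ℕ => m n / √(n:ℝ)) atTop (𝓝 0) := by
    refine (mn_small hν0 hνint η hη h1 h2).congr fun n => ?_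
    simp only [itail_eq' hνint (hη n), hm, Kf]
  have hs0 : Tendsto (fun n : ℕ => 1 / √(n:ℝ)) atTop (𝓝 0) := by
    simp only [one_div]
    exact tendsto_inv_atTop_zero.comp (Real.tendsto_sqrt_atTop.comp tendsto_natCast_atTop_atTop)
  have hmN : Tendsto (fun n : ℕ => m n / n) atTop (𝓝 0) := by
    have := hms.mul hs0
    rw [zero_mul] at this
    refine this.congr fun n => ?_
    rw [div_mul_div_comm, mul_one, Real.mul_self_sqrt (Nat.cast_nonneg n)]
  have hm2N : Tendsto (fun n : ℕ => m n * m n / n) atTop (𝓝 0) := by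
    have := hms.mul hms
    rw [zero_mul] at this
    refine this.congr fun n => ?_
    rw [div_mul_div_comm, Real.mul_self_sqrt (Nat.cast_nonneg n)]
  have hbN : Tendsto (fun n : ℕ => b / (n:ℝ)) atTop (𝓝 0) := tendsto_const_div_atTop_nhds_zero_nat b
  set κ : ℕ → ℝ := fun n => (b + m n) / n * m n with hκ
  have hκ0 : Tendsto κ atTop (𝓝 0) := by
    have := (hmN.const_mul b).add hm2N
    rw [mul_zero, add_zero] at this
    refine this.congr fun n => ?_
    simp only [hκ]; ring
  set ε : ℕ → ℝ := fun n => (b + m n) / n + m n / n with hε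
  have hε0 : Tendsto ε atTop (𝓝 0) := by
    have := (hbN.add hmN).add hmN
    simp only [add_zero] at this
    refine this.congr fun n => ?_
    simp only [hε]; ring
  set k : ℝ → ℝ := fun t => b + Kf ν t with hk
  set kn : ℕ → ℝ → ℝ := fun n t => b + Kf ν (η n + t) + (b + m n) / n * (m n - Kf ν (η n + t)) with hkn
  set δ : ℕ → ℝ := fun n => ∫ t in Ioi (0:ℝ), Real.exp (-β * t) * |kn n t - k t| with hδ
  have hKm := Kf_meas (ν := ν)
  have hcorr : ∀ n, 1 ≤ n → ∀ t, 0 ≤ t → 0 ≤ m n - Kf ν (η n + t) ∧ m n - Kf ν (η n + t) ≤ m n := by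
    intro n hn t ht
    exact ⟨sub_nonneg.2 (Kf_anti (h1 n hn).2 (by linarith)), by linarith [Kf_nonneg (ν := ν) (η n + t)]⟩
  have hcorr2 : ∀ n, 1 ≤ n → ∀ t, 0 ≤ t → 0 ≤ (b + m n) / n * (m n - Kf ν (η n + t)) ∧
      (b + m n) / n * (m n - Kf ν (η n + t)) ≤ κ n := by
    intro n hn t ht
    obtain ⟨h3, h4⟩ := hcorr n hn t ht
    have : 0 ≤ (b + m n) / n := div_nonneg (add_nonneg hb (hm0 n)) (Nat.cast_nonneg n)
    exact ⟨mul_nonneg this h3, mul_le_mul_of_nonneg_left h4 this⟩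
  have hKK : ∀ n t, 0 < t → Kf ν (η n + t) ≤ Kf ν t := fun n t ht =>
    Kf_anti (JJ_lt_top hν0 hνint ht) (by linarith [hη n])
  have hκ1 : ∀ᶠ n in atTop, κ n < 1 := hκ0.eventually (gt_mem_nhds zero_lt_one)
  have hδ0 : Tendsto δ atTop (𝓝 0) := by
    rw [← integral_zero ℝ ℝ (μ := volume.restrict (Ioi (0:ℝ)))]
    refine tendsto_integral_filter_of_dominated_convergence
      (fun t => Real.exp (-β * t) * (1 + Kf ν t)) ?_ ?_ (exp_k_int hν0 hνint hβ 1) ?_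
    · filter_upwards with n
      exact Measurable.aestronglyMeasurable (by fun_prop)
    · filter_upwards [hκ1, eventually_ge_atTop 1] with n hn1 hn
      filter_upwards [ae_restrict_mem measurableSet_Ioi] with t ht
      have ht : 0 < t := ht
      obtain ⟨h3, h4⟩ := hcorr2 n hn t ht.le
      rw [Real.norm_eq_abs, abs_mul, abs_abs, abs_of_pos (Real.exp_pos _)]
      gcongr
      have := hKK n t ht
      have := Kf_nonneg (ν := ν) (η n + t)
      simp only [hkn, hk]
      rw [abs_le]; constructor <;> linarith
    · filter_upwards [ae_restrict_mem measurableSet_Ioi] with t ht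
      have ht : 0 < t := ht
      have h3 : Tendsto (fun n => (b + m n) / n * (m n - Kf ν (η n + t))) atTop (𝓝 0) := by
        refine tendsto_of_tendsto_of_tendsto_of_le_of_le' tendsto_const_nhds hκ0 ?_ ?_
        · filter_upwards [eventually_ge_atTop 1] with n hn using (hcorr2 n hn t ht.le).1
        · filter_upwards [eventually_ge_atTop 1] with n hn using (hcorr2 n hn t ht.le).2
      have h4 := (((Kf_tendsto hν0 hνint ht η hη hη0).const_add b).add h3).sub_const (k t)
      have h5 : b + Kf ν t + 0 - k t = 0 := by simp [hk]
      rw [h5] at h4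
      have h6 := (h4.abs).const_mul (Real.exp (-β * t))
      simpa using h6
  refine ⟨β, hβ, fun n => 2 / c * (ε n + δ n / c), ?_, ?_⟩
  · have := (hε0.add (hδ0.div_const c)).const_mul (2 / c)
    simpa using this
  have hg1 : ∀ᶠ n in atTop, (b + m n) / n < 1 := by
    have : Tendsto (fun n : ℕ => (b + m n) / n) atTop (𝓝 0) := by
      have := hbN.add hmN
      rw [add_zero] at this
      exact this.congr fun n => by ring
    exact this.eventually (gt_mem_nhds zero_lt_one)
  filter_upwards [hκ1, hg1, eventually_ge_atTop 1] with n hn1 hn2 hn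
  have hN : (0:ℝ) < n := by exact_mod_cast hn
  have hg : c * gam b c ν η n = 1 - (b + m n) / n := by
    unfold gam
    rw [m_eq hνint (hη n), max_eq_right]
    · field_simp; simp only [hm]; ring
    · have : (b + Kf ν (η n)) / n < 1 := hn2
      rw [add_div] at this
      rw [one_div_mul_eq_div]; linarith
  have hgp : 0 ≤ (b + m n) / n := div_nonneg (add_nonneg hb (hm0 n)) hN.le
  have hbd : ∀ t, 0 < t → 0 ≤ kn n t ∧ kn n t ≤ b + 1 + Kf ν t := by
    intro t ht
    obtain ⟨h3, h4⟩ := hcorr2 n hn t ht.le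
    have := hKK n t ht
    have := Kf_nonneg (ν := ν) (η n + t)
    simp only [hkn]
    constructor <;> linarith
  have hknint : IntegrableOn (fun u => Real.exp (-β * u) * kn n u) (Ioi 0) := by
    refine Integrable.mono' (exp_k_int hν0 hνint hβ (b + 1)) ?_ ?_
    · exact Measurable.aestronglyMeasurable (by fun_prop)
    · filter_upwards [ae_restrict_mem measurableSet_Ioi] with t ht
      rw [Real.norm_eq_abs, abs_mul, abs_of_pos (Real.exp_pos _), abs_of_nonneg (hbd t ht).1]
      gcongr
      exact (hbd t ht).2
  have hRn := hR n hn
  refine stab (r := fun t => R n (n * t)) (a := fun t => (1 - (b + m n) / n) * (1 + (m n - Kf ν (η n + t)) / n))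
    hc hβ.le V k (kn n) hV (by fun_prop) ?_ (fun t ht => (hbd t ht).1)
    (exp_k_int hν0 hνint hβ b) hknint ?_ ?_ ?_ ?_ le_rfl
  · intro t; rw [abs_of_nonneg (hV0 t)]; exact hVb t
  · filter_upwards [hVeq, ae_restrict_mem measurableSet_Ioi] with t ht ht0
    have ht0 : 0 < t := ht0
    rw [← ht]
    congr 1
    refine intervalIntegral.integral_congr fun s hs => ?_
    rw [uIcc_of_le ht0.le] at hs
    simp only [hk, Kf]
    rw [itail_eq' hνint (by linarith [hs.2])]
  · intro t ht
    have h3 := hReq n hn t ht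
    rw [hg, A_eq hνint (hη n) ht (h1 n hn).2] at h3
    refine Eq.trans ?_ h3
    congr 1
    refine intervalIntegral.integral_congr fun s hs => ?_
    rw [uIcc_of_le ht] at hs
    rw [A_eq hνint (hη n) (by linarith [hs.2]) (h1 n hn).2]
    congr 1
    simp only [hkn, hm]
    field_simp
    ring
  · intro t ht
    obtain ⟨h3, h4⟩ := hcorr n hn t ht
    have h5 : 0 ≤ (m n - Kf ν (η n + t)) / n := div_nonneg h3 hN.le
    have h6 : (m n - Kf ν (η n + t)) / n ≤ m n / n := by gcongr
    simp only [hε]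
    set p := (b + m n) / n
    set q := (m n - Kf ν (η n + t)) / n
    rw [abs_le]
    constructor <;> nlinarith
  · refine le_trans ?_ hβc
    exact setIntegral_mono_on hknint (exp_k_int hν0 hνint hβ (b + 1)) measurableSet_Ioi fun t ht =>
      mul_le_mul_of_nonneg_left (hbd t ht).2 (Real.exp_pos _).le


lemma final_first (P : ℕ → ℝ → ℝ) (W' V : ℝ → ℝ) (hVW : ∀ t, 0 ≤ t → V t = W' t)
    (R : ℕ → ℝ → ℝ)
    (hP : ∀ n, 1 ≤ n → ∀ t, 0 ≤ t → P n t = R n t)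
    {β₁ : ℝ} (e : ℕ → ℝ) (he : Tendsto e atTop (𝓝 0))
    (hest : ∀ᶠ n : ℕ in atTop, ∀ t, 0 ≤ t → Real.exp (-β₁ * t) * |R n (n * t) - V t| ≤ e n)
    {β : ℝ} (hβ : β₁ + 1 ≤ β) :
    Tendsto (fun n : ℕ => ∫ t in Ioi (0:ℝ), Real.exp (-2 * β * t) * |P n (n * t) - W' t| ^ 2)
      atTop (𝓝 0) := by
  have h0 : Tendsto (fun n => e n ^ 2 * ∫ t in Ioi (0:ℝ), Real.exp (-2 * t)) atTop (𝓝 0) := by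
    simpa using (he.pow 2).mul_const (∫ t in Ioi (0:ℝ), Real.exp (-2 * t))
  refine tendsto_of_tendsto_of_tendsto_of_le_of_le' tendsto_const_nhds h0 ?_ ?_
  · filter_upwards with n
    exact integral_nonneg fun t => by positivity
  · filter_upwards [hest, eventually_ge_atTop 1] with n hn hn1
    rw [← integral_const_mul]
    refine integral_mono_of_nonneg ?_ ((exp_neg_integrableOn_Ioi 0 two_pos).const_mul _) ?_
    · filter_upwards with t; positivity
    · filter_upwards [ae_restrict_mem measurableSet_Ioi] with t ht
      have ht : 0 < t := ht
      have h1 := hn t ht.le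
      rw [hP n hn1 _ (by positivity), ← hVW t ht.le]
      have h2 : Real.exp (-2 * β * t) ≤ Real.exp (-2 * t) * Real.exp (-β₁ * t) ^ 2 := by
        rw [← Real.exp_nat_mul, ← Real.exp_add]
        refine Real.exp_le_exp.2 ?_
        push_cast; nlinarith
      calc _ ≤ Real.exp (-2 * t) * Real.exp (-β₁ * t) ^ 2 * |R n (n * t) - V t| ^ 2 := by gcongr
        _ = Real.exp (-2 * t) * (Real.exp (-β₁ * t) * |R n (n * t) - V t|) ^ 2 := by ring
        _ ≤ Real.exp (-2 * t) * (e n) ^ 2 := by gcongr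
        _ = _ := by ring

lemma P_int (P R : ℝ → ℝ) (hneg : ∀ t, t < 0 → P t = 0) (hP : ∀ t, 0 ≤ t → P t = R t)
    (hR : Continuous R) (a b : ℝ) : IntervalIntegrable P volume a b := by
  have h1 : P = (Ici 0).indicator R := by
    ext t
    by_cases h : 0 ≤ t
    · rw [indicator_of_mem (show t ∈ Ici 0 from h), hP t h]
    · rw [indicator_of_notMem (show t ∉ Ici 0 from h), hneg t (not_le.1 h)]
  rw [h1, intervalIntegrable_iff]
  exact ((hR.intervalIntegrable a b).def').indicator measurableSet_Ici

lemma final_second (c y : ℝ) (hc : 0 < c) (hy : 0 < y) (P Q : ℕ → ℝ → ℝ) (W' V : ℝ → ℝ)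
    (hVW : ∀ t, 0 ≤ t → V t = W' t) (hV : Continuous V) (hV0 : ∀ t, 0 ≤ V t) (hVb : ∀ t, V t ≤ 1 / c)
    (R : ℕ → ℝ → ℝ) (hR : ∀ n, 1 ≤ n → Continuous (R n))
    (hneg : ∀ n, ∀ t, t < 0 → P n t = 0)
    (hP : ∀ n, 1 ≤ n → ∀ t, 0 ≤ t → P n t = R n t)
    (hQ : ∀ n, ∀ t, 0 ≤ t → Q n t = (if t < y then 1 else 0) + ∫ s in (t - y)..t, P n s)
    {β₁ : ℝ} (hβ₁ : 0 < β₁) (e : ℕ → ℝ) (he : Tendsto e atTop (𝓝 0))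
    (hest : ∀ᶠ n : ℕ in atTop, ∀ t, 0 ≤ t → Real.exp (-β₁ * t) * |R n (n * t) - V t| ≤ e n)
    {β : ℝ} (hβ : β₁ + 1 ≤ β) :
    Tendsto (fun n : ℕ => ∫ t in Ioi (0:ℝ), Real.exp (-2 * β * t) * |Q n (n * t) - y * W' t| ^ 2)
      atTop (𝓝 0) := by
  have hest' : ∀ᶠ n : ℕ in atTop, ∀ t, 0 ≤ t → |R n (n * t) - V t| ≤ e n * Real.exp (β₁ * t) := by
    filter_upwards [hest] with n hn t ht
    have := hn t ht
    calc |R n (n * t) - V t| = (Real.exp (-β₁ * t) * |R n (n * t) - V t|) * Real.exp (β₁ * t) := by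
          rw [mul_right_comm, ← Real.exp_add]; simp
      _ ≤ _ := by gcongr
  suffices hsuf : Tendsto (fun n : ℕ => ∫ t in Ioi (0:ℝ), Real.exp (-2 * β * t) * |Q n (n * t) - y * W' t| ^ 2)
      atTop (𝓝 (∫ t in Ioi (0:ℝ), (0:ℝ))) by
    rw [integral_zero] at hsuf; exact hsuf
  set C := 1 + (1 / c + 1) * y + y / c with hC
  refine tendsto_integral_filter_of_dominated_convergence
      (fun t => Real.exp (-2 * t) * C ^ 2) ?_ ?_ (exp_int two_pos _) ?_
  · filter_upwards [eventually_ge_atTop 1] with n hn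
    have hPi := P_int (P n) (R n) (hneg n) (hP n hn) (hR n hn)
    have hF : Continuous fun x => ∫ s in (0:ℝ)..x, P n s := intervalIntegral.continuous_primitive hPi 0
    set F := fun x => ∫ s in (0:ℝ)..x, P n s with hFd
    have hm : Measurable fun t : ℝ => Real.exp (-2 * β * t) *
        |((if (n:ℝ) * t < y then (1:ℝ) else 0) + (F (n * t) - F (n * t - y))) - y * V t| ^ 2 := by
      have h1 : Measurable fun t : ℝ => if (n:ℝ) * t < y then (1:ℝ) else 0 :=
        Measurable.ite (measurableSet_lt (by fun_prop) (by fun_prop)) measurable_const measurable_const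
      have h2 : Measurable fun t : ℝ => F (n * t) := (by fun_prop : Continuous _).measurable
      have h3 : Measurable fun t : ℝ => F (n * t - y) := (by fun_prop : Continuous _).measurable
      have h4 := hV.measurable
      fun_prop
    refine hm.aestronglyMeasurable.congr ?_
    filter_upwards [ae_restrict_mem measurableSet_Ioi] with t ht
    have ht : 0 < t := ht
    rw [hQ n _ (by positivity), hVW t ht.le]
    simp only [hFd]
    rw [intervalIntegral.integral_interval_sub_left (hPi _ _) (hPi _ _)]
  · filter_upwards [hest', eventually_ge_atTop 1, he.eventually (gt_mem_nhds zero_lt_one)] with n hn hn1 he1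
    filter_upwards [ae_restrict_mem measurableSet_Ioi] with t ht
    have ht : 0 < t := ht
    have hN : (0:ℝ) < n := by exact_mod_cast hn1
    have hexp1 : 1 ≤ Real.exp (β₁ * t) := Real.one_le_exp (by positivity)
    have hPb : ∀ s, s ≤ n * t → |P n s| ≤ (1 / c + 1) * Real.exp (β₁ * t) := by
      intro s hs
      by_cases h : 0 ≤ s
      · have h1 := hn (s / n) (by positivity)
        rw [mul_div_cancel₀ _ hN.ne'] at h1
        rw [hP n hn1 s h]
        have h2 : s / n ≤ t := by rw [div_le_iff₀ hN]; linarith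
        have h3 : Real.exp (β₁ * (s / n)) ≤ Real.exp (β₁ * t) := by gcongr
        have h4 : e n * Real.exp (β₁ * (s / n)) ≤ 1 * Real.exp (β₁ * t) :=
          mul_le_mul he1.le h3 (Real.exp_pos _).le zero_le_one
        have h5 : |R n s| ≤ |R n s - V (s / n)| + |V (s / n)| := by
          have := abs_add_le (R n s - V (s / n)) (V (s / n)); simpa using this
        have h6 : |V (s / n)| ≤ 1 / c := by rw [abs_of_nonneg (hV0 _)]; exact hVb _
        have h7 : 1 / c * 1 ≤ 1 / c * Real.exp (β₁ * t) := by gcongr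
        linarith
      · rw [hneg n s (not_le.1 h), abs_zero]; positivity
    have hI : |∫ s in (n * t - y)..(n * t), P n s| ≤ (1 / c + 1) * Real.exp (β₁ * t) * y := by
      have := intervalIntegral.norm_integral_le_of_norm_le_const (f := P n) (a := n * t - y) (b := n * t)
        (C := (1 / c + 1) * Real.exp (β₁ * t)) (fun s hs => by
          rw [uIoc_of_le (by linarith)] at hs
          exact hPb s hs.2)
      rw [Real.norm_eq_abs] at this
      simpa [abs_of_pos hy] using this
    have hD : |Q n (n * t) - y * W' t| ≤ C * Real.exp (β₁ * t) := by
      rw [hQ n _ (by positivity), ← hVW t ht.le]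
      have h1 : |(if (n:ℝ) * t < y then (1:ℝ) else 0)| ≤ 1 := by split_ifs <;> simp
      have h2 : |y * V t| ≤ y / c := by
        rw [abs_mul, abs_of_pos hy, abs_of_nonneg (hV0 _), div_eq_mul_one_div]
        exact mul_le_mul_of_nonneg_left (hVb t) hy.le
      have h3 := (abs_sub ((if (n:ℝ) * t < y then (1:ℝ) else 0) + ∫ s in (n * t - y)..(n * t), P n s) (y * V t))
      have h4 := abs_add_le (if (n:ℝ) * t < y then (1:ℝ) else 0) (∫ s in (n * t - y)..(n * t), P n s)
      have h5 : y / c * 1 ≤ y / c * Real.exp (β₁ * t) := by gcongr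
      have h6 : C * Real.exp (β₁ * t) = Real.exp (β₁ * t) + (1 / c + 1) * Real.exp (β₁ * t) * y +
        y / c * Real.exp (β₁ * t) := by rw [hC]; ring
      rw [h6]; linarith
    rw [Real.norm_eq_abs, abs_of_nonneg (by positivity)]
    calc _ ≤ Real.exp (-2 * β * t) * (C * Real.exp (β₁ * t)) ^ 2 := by gcongr
      _ = (Real.exp (-2 * β * t) * Real.exp (β₁ * t) ^ 2) * C ^ 2 := by ring
      _ ≤ _ := by
        gcongr
        rw [← Real.exp_nat_mul, ← Real.exp_add]
        refine Real.exp_le_exp.2 ?_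
        push_cast; nlinarith
  · filter_upwards [ae_restrict_mem measurableSet_Ioi] with t ht
    have ht : 0 < t := ht
    have hlim : Tendsto (fun n : ℕ => Q n (n * t) - y * W' t) atTop (𝓝 0) := by
      rw [Metric.tendsto_nhds]
      intro ω hω
      set w := ω / (2 * y) with hw
      have hw0 : 0 < w := by positivity
      obtain ⟨ρ, hρ, hcont⟩ := Metric.continuous_iff.1 hV t (w / 2) (by positivity)
      have t1 : Tendsto (fun n : ℕ => y / (n:ℝ)) atTop (𝓝 0) := tendsto_const_div_atTop_nhds_zero_nat y
      have t2 : Tendsto (fun n : ℕ => e n * Real.exp (β₁ * t)) atTop (𝓝 0) := by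
        simpa using he.mul_const (Real.exp (β₁ * t))
      filter_upwards [hest', eventually_ge_atTop 1, t1.eventually (gt_mem_nhds hρ),
        t1.eventually (gt_mem_nhds ht), t2.eventually (gt_mem_nhds (half_pos hw0))] with
        n hn hn1 h1 h2 h3
      have hN : (0:ℝ) < n := by exact_mod_cast hn1
      have hPi := P_int (P n) (R n) (hneg n) (hP n hn1) (hR n hn1)
      have h4 : y < n * t := by rw [div_lt_iff₀ hN] at h2; linarith
      rw [Real.dist_eq, sub_zero, hQ n _ (by positivity), if_neg (by linarith), zero_add, ← hVW t ht.le]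
      have e1 : (∫ s in (n * t - y)..(n * t), P n s) - y * V t =
          ∫ s in (n * t - y)..(n * t), (P n s - V t) := by
        rw [intervalIntegral.integral_sub (hPi _ _) (by simp)]; simp
      have h5 := intervalIntegral.norm_integral_le_of_norm_le_const (f := fun s => P n s - V t)
        (a := n * t - y) (b := n * t) (C := w) (fun s hs => by
          rw [uIoc_of_le (by linarith)] at hs
          have hs0 : 0 ≤ s := by linarith [hs.1]
          rw [hP n hn1 s hs0, Real.norm_eq_abs]
          have g1 := hn (s / n) (by positivity)
          rw [mul_div_cancel₀ _ hN.ne'] at g1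
          have g2 : s / n ≤ t := by rw [div_le_iff₀ hN]; linarith [hs.2]
          have g0 : 0 ≤ e n := by
            have := hn 0 le_rfl
            have := (abs_nonneg _).trans this
            simpa using this
          have g3 : e n * Real.exp (β₁ * (s / n)) ≤ e n * Real.exp (β₁ * t) := by gcongr
          have g4 : dist (V (s / n)) (V t) < w / 2 := by
            refine hcont _ ?_
            rw [Real.dist_eq, abs_sub_comm, abs_of_nonneg (by linarith)]
            refine lt_of_le_of_lt ?_ h1
            rw [le_div_iff₀ hN, sub_mul, div_mul_cancel₀ _ hN.ne']
            linarith [hs.1]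
          rw [Real.dist_eq] at g4
          have g5 := abs_sub_le (R n s) (V (s / n)) (V t)
          linarith)
      rw [e1, ← Real.norm_eq_abs]
      refine lt_of_le_of_lt h5 ?_
      have : |(n:ℝ) * t - (n * t - y)| = y := by rw [sub_sub_cancel, abs_of_pos hy]
      rw [this, hw]
      have : ω / (2 * y) * y = ω / 2 := by field_simp
      rw [this]; linarith
    have := ((hlim.abs).pow 2).const_mul (Real.exp (-2 * β * t))
    simpa using this

theorem stmt13x
    (b c : ℝ) (hb : 0 ≤ b) (hc : 0 < c)
    (ν : Measure ℝ) (hν0 : ν (Set.Iic 0) = 0)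
    (hνint : ∫⁻ y in Set.Ioi (0 : ℝ), ENNReal.ofReal (min y (y ^ 2)) ∂ν ≠ ⊤)
    (W W' : ℝ → ℝ)
    (hWnonneg : ∀ x : ℝ, 0 ≤ W x)
    (hWcont : ContinuousOn W (Set.Ici 0))
    (hWmono : StrictMonoOn W (Set.Ici 0))
    (hWlap : ∀ l : ℝ, 0 < l →
      (∫ x in Set.Ioi (0 : ℝ), Real.exp (-l * x) * W x) = 1 / phi b c ν l)
    (hW'zero : W' 0 = 1 / c)
    (hW'deriv : ∀ x : ℝ, 0 < x → HasDerivAt W (W' x) x)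
    (hW'cont : ContinuousOn W' (Set.Ici 0))
    (η θ : ℕ → ℝ) (hη : ∀ n : ℕ, 0 ≤ η n)
    (hseq : (ν (Set.Ici (0 : ℝ)) ≠ ⊤ ∧ (∀ n : ℕ, 1 ≤ n → η n = 0) ∧
        (∀ n : ℕ, 1 ≤ n → θ n = c * tailNu ν 0 / (n : ℝ) ^ 2)) ∨
      (ν (Set.Ici (0 : ℝ)) = ⊤ ∧
        Filter.Tendsto (fun n : ℕ => (n : ℝ) * θ n) Filter.atTop (nhds 0) ∧
        Filter.Tendsto (fun n : ℕ => (n : ℝ) ^ 2 * θ n) Filter.atTop Filter.atTop ∧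
        (∀ n : ℕ, 1 ≤ n → tailNu ν (η n) = (n : ℝ) ^ 2 * θ n / c)))
    (Λ : ℕ → Measure ℝ)
    (hΛprob : ∀ n : ℕ, 1 ≤ n → IsProbabilityMeasure (Λ n))
    (hΛsupp : ∀ n : ℕ, 1 ≤ n → Λ n (Set.Iic 0) = 0)
    (hΛtail : ∀ n : ℕ, 1 ≤ n → ∀ y : ℝ, 0 ≤ y →
      ((Λ n) (Set.Ici y)).toReal = tailNu ν (η n + y / (n : ℝ)) / tailNu ν (η n))
    :
    ∃ β₀ : ℝ, 0 ≤ β₀ ∧ ∀ β : ℝ, β₀ ≤ β → ∀ y : ℝ, 0 < y →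
      Filter.Tendsto
        (fun n : ℕ =>
          (∫ t in Set.Ioi (0 : ℝ),
            Real.exp (-2 * β * t) * |RPi b c ν η θ Λ n ((n : ℝ) * t) - W' t| ^ 2) +
          ∫ t in Set.Ioi (0 : ℝ),
            Real.exp (-2 * β * t) * |Rtwo b c ν η θ Λ n ((n : ℝ) * t) y - y * W' t| ^ 2)
        Filter.atTop (nhds 0) := by
  obtain ⟨V, hV, hVW, hV0, hVb, hVeq⟩ := W_volterra b c hb hc ν hν0 hνint W W' hWnonneg hWcont hWmono
    hWlap hW'zero hW'deriv hW'cont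
  obtain ⟨s1, s2, s3⟩ := seq_props c hc ν hν0 hνint η θ hη hseq Λ hΛprob hΛtail hΛsupp
  have hex : ∀ n : ℕ, ∃ R : ℝ → ℝ, 1 ≤ n → Continuous R ∧ (∀ t, 0 ≤ t → RPi b c ν η θ Λ n t = R t) ∧
      ∀ t, 0 ≤ t → c * R (n * t) + ∫ s in (0:ℝ)..t,
        (n * (1 - c * gam b c ν η n) - c * gam b c ν η n *
          ∫ v in (0:ℝ)..(t - s), tailNu ν (η n + v)) * R (n * s) =
        c * gam b c ν η n * (1 + (∫ v in (0:ℝ)..t, tailNu ν (η n + v)) / n) := by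
    intro n
    by_cases hn : 1 ≤ n
    · obtain ⟨R, hR⟩ := R_props b c hc ν η θ Λ n hn (hΛprob n hn) (hΛsupp n hn) (s1 n hn).1
        (s1 n hn).2.1 (hΛtail n hn)
      exact ⟨R, fun _ => hR⟩
    · exact ⟨fun _ => 0, fun h => absurd h hn⟩
  choose R hR using hex
  obtain ⟨β₁, hβ₁, e, he, hest⟩ := main_est b c hb hc ν hν0 hνint η hη (fun n hn => (s1 n hn).2.2) s2 s3
    V hV hV0 hVb hVeq R (fun n hn => (hR n hn).1) (fun n hn => (hR n hn).2.2)
  refine ⟨β₁ + 1, by linarith, fun β hβ y hy => ?_⟩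
  have f1 := final_first (fun n => RPi b c ν η θ Λ n) W' V hVW R (fun n hn => (hR n hn).2.1) e he hest hβ
  have f2 := final_second c y hc hy (fun n => RPi b c ν η θ Λ n) (fun n t => Rtwo b c ν η θ Λ n t y) W' V
    hVW hV hV0 hVb R (fun n hn => (hR n hn).1)
    (fun n t ht => by simp [RPi, resolventSnd, ht]) (fun n hn => (hR n hn).2.1)
    (fun n t ht => by simp only [Rtwo]; rw [if_neg (by rintro (h | h) <;> linarith)])
    hβ₁ e he hest hβ
  simpa using f1.add f2

end helpers

/-- Lemma 4.9: weighted `L²` convergence of `R_{Π_n}(n·)` to `W′` and of `R_n(n·,y)` to `y·W′`. -/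
theorem stmt13
    (b c : ℝ) (hb : 0 ≤ b) (hc : 0 < c)
    (ν : Measure ℝ) (hν0 : ν (Set.Iic 0) = 0)
    (hνint : ∫⁻ y in Set.Ioi (0 : ℝ), ENNReal.ofReal (min y (y ^ 2)) ∂ν ≠ ⊤)
    (W W' : ℝ → ℝ)
    (hWneg : ∀ x : ℝ, x < 0 → W x = 0)
    (hWnonneg : ∀ x : ℝ, 0 ≤ W x)
    (hWcont : ContinuousOn W (Set.Ici 0))
    (hWmono : StrictMonoOn W (Set.Ici 0))
    (hWlap : ∀ l : ℝ, 0 < l →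
      (∫ x in Set.Ioi (0 : ℝ), Real.exp (-l * x) * W x) = 1 / phi b c ν l)
    (hW'neg : ∀ x : ℝ, x < 0 → W' x = 0)
    (hW'zero : W' 0 = 1 / c)
    (hW'deriv : ∀ x : ℝ, 0 < x → HasDerivAt W (W' x) x)
    (hW'cont : ContinuousOn W' (Set.Ici 0))
    (η θ : ℕ → ℝ) (hη : ∀ n : ℕ, 0 ≤ η n) (hθ : ∀ n : ℕ, 0 ≤ θ n ∧ θ n < 1)
    (hseq : (ν (Set.Ici (0 : ℝ)) ≠ ⊤ ∧ (∀ n : ℕ, 1 ≤ n → η n = 0) ∧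
        (∀ n : ℕ, 1 ≤ n → θ n = c * tailNu ν 0 / (n : ℝ) ^ 2)) ∨
      (ν (Set.Ici (0 : ℝ)) = ⊤ ∧
        Filter.Tendsto (fun n : ℕ => (n : ℝ) * θ n) Filter.atTop (nhds 0) ∧
        Filter.Tendsto (fun n : ℕ => (n : ℝ) ^ 2 * θ n) Filter.atTop Filter.atTop ∧
        (∀ n : ℕ, 1 ≤ n → tailNu ν (η n) = (n : ℝ) ^ 2 * θ n / c)))
    (Λ : ℕ → Measure ℝ)
    (hΛprob : ∀ n : ℕ, 1 ≤ n → IsProbabilityMeasure (Λ n))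
    (hΛsupp : ∀ n : ℕ, 1 ≤ n → Λ n (Set.Iic 0) = 0)
    (hΛtail : ∀ n : ℕ, 1 ≤ n → ∀ y : ℝ, 0 ≤ y →
      ((Λ n) (Set.Ici y)).toReal = tailNu ν (η n + y / (n : ℝ)) / tailNu ν (η n))
    :
    ∃ β₀ : ℝ, 0 ≤ β₀ ∧ ∀ β : ℝ, β₀ ≤ β → ∀ y : ℝ, 0 < y →
      Filter.Tendsto
        (fun n : ℕ =>
          (∫ t in Set.Ioi (0 : ℝ),
            Real.exp (-2 * β * t) * |RPi b c ν η θ Λ n ((n : ℝ) * t) - W' t| ^ 2) +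
          ∫ t in Set.Ioi (0 : ℝ),
            Real.exp (-2 * β * t) * |Rtwo b c ν η θ Λ n ((n : ℝ) * t) y - y * W' t| ^ 2)
        Filter.atTop (nhds 0) := by
  exact stmt13x b c hb hc ν hν0 hνint W W' hWnonneg hWcont hWmono hWlap hW'zero hW'deriv hW'cont η θ
    hη hseq Λ hΛprob hΛsupp hΛtail
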